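/- There is an n₀ such that every fair complete k-partite graph on more than n₀ vertices whose edges are coloured red and blue can be partitioned into 14 vertex-disjoint monochromatic cycles; that is, its vertex set is the disjoint union of the vertex sets of at most 14 monochromatic cycles. -/

import Mathlib

open SimpleGraph Set

/- Convention: colour `true` is red, colour `false` is blue. -/

/-- The subgraph of `G` consisting of the edges of colour `b`. -/
def monoSubgraph {V : Type*} (G : SimpleGraph V) (c : Sym2 V → Bool) (b : Bool) :
    SimpleGraph V :=
  SimpleGraph.fromEdgeSet {e | e ∈ G.edgeSet ∧ c e = b}

/-- `S` is the vertex set of a (possibly empty, possibly trivial) path of `G`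
all of whose edges have colour `b`. -/
def IsMonoPathSet {V : Type*} (G : SimpleGraph V) (c : Sym2 V → Bool) (b : Bool)
    (S : Set V) : Prop :=
  S = ∅ ∨ ∃ (u v : V) (p : G.Walk u v), p.IsPath ∧ (∀ e ∈ p.edges, c e = b) ∧
    S = {x | x ∈ p.support}

/-- `S` is the vertex set of a (possibly degenerate: empty, single vertex or single edge)
cycle of `G` all of whose edges have colour `b`. -/
def IsMonoCycleSet {V : Type*} (G : SimpleGraph V) (c : Sym2 V → Bool) (b : Bool)
    (S : Set V) : Prop :=
  S = ∅ ∨ (∃ v, S = {v}) ∨ (∃ u v, G.Adj u v ∧ c s(u, v) = b ∧ S = {u, v}) ∨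
    ∃ (v : V) (p : G.Walk v v), p.IsCycle ∧ (∀ e ∈ p.edges, c e = b) ∧
      S = {x | x ∈ p.support}

/-- `M` is a matching of `G` in colour `b` which is connected, i.e. all its edges lie in one
connected component of the subgraph formed by the edges of colour `b`. -/
def IsConnMatching {V : Type*} (G : SimpleGraph V) (c : Sym2 V → Bool) (b : Bool)
    (M : Set (Sym2 V)) : Prop :=
  (∀ e ∈ M, e ∈ G.edgeSet ∧ c e = b) ∧
  (∀ e ∈ M, ∀ f ∈ M, e ≠ f → ∀ x, x ∈ e → x ∉ f) ∧
  (∀ e ∈ M, ∀ f ∈ M, ∀ x, x ∈ e → ∀ y, y ∈ f → (monoSubgraph G c b).Reachable x y)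

/-- The set of vertices covered by a set of edges. -/
def matchSupport {V : Type*} (M : Set (Sym2 V)) : Set V := {x | ∃ e ∈ M, x ∈ e}

/-- The colouring `c` of the (bipartite, with classes `U` and `W`) graph `G` is a split
colouring: `U = A ∪ B`, `W = C ∪ D`, the edges between `A,C` and between `B,D` are blue
(`false`), and the edges between `A,D` and between `B,C` are red (`true`). -/
def IsSplitColouring {V : Type*} (G : SimpleGraph V) (c : Sym2 V → Bool)
    (U W : Set V) : Prop :=
  ∃ A B C D : Set V,
    A ∪ B = U ∧ Disjoint A B ∧ C ∪ D = W ∧ Disjoint C D ∧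
    (∀ u v, G.Adj u v →
      (((u ∈ A ∧ v ∈ C) ∨ (u ∈ C ∧ v ∈ A) ∨ (u ∈ B ∧ v ∈ D) ∨ (u ∈ D ∧ v ∈ B)) →
        c s(u, v) = false)) ∧
    (∀ u v, G.Adj u v →
      (((u ∈ A ∧ v ∈ D) ∨ (u ∈ D ∧ v ∈ A) ∨ (u ∈ B ∧ v ∈ C) ∨ (u ∈ C ∧ v ∈ B)) →
        c s(u, v) = true))

/-- The colouring `c` of `G` is `δ`-close to a split colouring: one can delete at most
`δ|E(G)|` edges so that the remaining graph is bipartite and the colouring on it is a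
split colouring. -/
def CloseToSplit {V : Type*} (G : SimpleGraph V) (c : Sym2 V → Bool) (δ : ℝ) : Prop :=
  ∃ F : Set (Sym2 V), F ⊆ G.edgeSet ∧ (F.ncard : ℝ) ≤ δ * (G.edgeSet.ncard : ℝ) ∧
    ∃ U W : Set V, U ∪ W = Set.univ ∧ Disjoint U W ∧
      (∀ u v, (G.deleteEdges F).Adj u v → ((u ∈ U ∧ v ∈ W) ∨ (u ∈ W ∧ v ∈ U))) ∧
      IsSplitColouring (G.deleteEdges F) c U W

section

open scoped Classical

/-- `l` lists the vertices of a cycle of `G` in cyclic order; the empty list and a pair of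
adjacent vertices are allowed as degenerate cycles. -/
def IsCycleList {V : Type*} (G : SimpleGraph V) (l : List V) : Prop :=
  l.Nodup ∧ l.IsChain G.Adj ∧ ∀ a ∈ l.head?, ∀ b ∈ l.getLast?, G.Adj b a

namespace IsCycleList

variable {V : Type*} {G H : SimpleGraph V} {l l₁ l₂ : List V}

lemma nil : IsCycleList G [] := by simp [IsCycleList]

lemma mono (hGH : G ≤ H) (h : IsCycleList G l) : IsCycleList H l :=
  ⟨h.1, h.2.1.imp fun _ _ hab => hGH hab, fun a ha b hb => hGH (h.2.2 a ha b hb)⟩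

lemma append_comm (h : IsCycleList G (l₁ ++ l₂)) : IsCycleList G (l₂ ++ l₁) := by
  rcases l₁.eq_nil_or_concat with rfl | ⟨l₁', a, rfl⟩
  · simpa using h
  rcases l₂ with _ | ⟨b, l₂'⟩
  · simpa using h
  obtain ⟨h1, h2, h3⟩ := h
  refine ⟨(List.perm_append_comm).nodup_iff.1 h1, ?_, ?_⟩
  · rw [List.isChain_append] at h2 ⊢
    refine ⟨h2.2.1, h2.1, fun x hx y hy => h3 y ?_ x ?_⟩
    · rw [List.head?_append, Option.mem_def.1 hy]; simp
    · rw [List.getLast?_append, Option.mem_def.1 hx]; simp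
  · intro x hx y hy
    rw [List.isChain_append] at h2
    have hx' : b = x := by simpa using hx
    have hy' : a = y := by
      rw [List.concat_eq_append, ← List.append_assoc, List.getLast?_append] at hy
      simpa using hy
    exact h2.2.2 y (by simp [hy']) x (by simp [hx'])

/-- A monochromatic cycle list is the vertex set of a (possibly degenerate) monochromatic
cycle. -/
lemma isMonoCycleSet {G : SimpleGraph V} {c : Sym2 V → Bool} {b : Bool}
    (h : IsCycleList (monoSubgraph G c b) l) : IsMonoCycleSet G c b {x | x ∈ l} := by
  have hadj : ∀ {u v}, (monoSubgraph G c b).Adj u v → G.Adj u v ∧ c s(u, v) = b := by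
    intro u v huv
    simp only [monoSubgraph, SimpleGraph.fromEdgeSet_adj] at huv
    exact huv.1
  obtain ⟨h1, h2, h3⟩ := h
  match l, h1, h2, h3 with
  | [], _, _, _ => left; simp
  | [a], _, _, _ => right; left; exact ⟨a, by simp⟩
  | [a, d], h1, h2, h3 =>
    right; right; left
    have := hadj (by simpa using h2 : (monoSubgraph G c b).Adj a d)
    exact ⟨a, d, this.1, this.2, by ext x; simp⟩
  | a :: d :: e :: l', h1, h2, h3 =>
    right; right; right
    set M := monoSubgraph G c b with hM
    have hle : M ≤ G := fun u v huv => (hadj huv).1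
    set l := a :: d :: e :: l' with hl
    have hne : l ≠ [] := by simp [hl]
    let p : M.Walk (l.head hne) (l.getLast hne) := Walk.ofSupport l hne h2
    have hps : p.support = l := Walk.support_ofSupport hne h2
    have hlast : M.Adj (l.getLast hne) (l.head hne) :=
      h3 _ (by simp [hl]) _ (List.getLast?_eq_some_getLast hne)
    have hpath : p.IsPath := by rw [Walk.isPath_def, hps]; exact h1
    have hlen : p.length = l'.length + 2 := by
      have := p.length_support
      rw [hps] at this
      simp [hl] at this
      omega
    have hcyc : (Walk.cons hlast p).IsCycle := by
      rw [Walk.cons_isCycle_iff]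
      refine ⟨hpath, fun hmem => ?_⟩
      have := hpath.length_eq_one_of_mem_edges (by rwa [Sym2.eq_swap] at hmem)
      omega
    refine ⟨_, (Walk.cons hlast p).mapLe hle, ?_, ?_, ?_⟩
    · exact (Walk.isCycle_mapLe hle).2 hcyc
    · intro e he
      rw [Walk.edges_mapLe_eq_edges] at he
      have := Walk.edges_subset_edgeSet _ he
      induction e with
      | _ u v => exact (hadj this).2
    · ext x
      simp only [Walk.support_mapLe_eq_support, Walk.support_cons, hps, Set.mem_ofPred_eq,
        List.mem_cons (a := x) (b := l.getLast hne)]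
      constructor
      · exact Or.inr
      · rintro (rfl | h)
        · exact List.getLast_mem hne
        · exact h

end IsCycleList

/-- No two sets of at least `h` vertices, one in `X` and one in `Y`, span no edge. -/
def NoHole {V : Type*} (G : SimpleGraph V) (X Y : Finset V) (h : ℕ) : Prop :=
  ∀ S ⊆ X, ∀ T ⊆ Y, h ≤ S.card → h ≤ T.card → ∃ s ∈ S, ∃ t ∈ T, G.Adj s t

section Bipartite

variable {V : Type*} {G : SimpleGraph V} {X Y : Finset V} {l : List V}

lemma card_toFinset_inter (hl : l.Nodup) (X : Finset V) :
    (l.toFinset ∩ X).card = l.countP (· ∈ X) := by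
  rw [List.countP_eq_length_filter, ← List.toFinset_card_of_nodup (hl.filter _)]
  congr 1
  ext x
  simp

lemma isChain_between_countP (hXY : Disjoint X Y) (a : V) (l : List V)
    (h : (a :: l).IsChain (G.between X Y).Adj) :
    let b := (a :: l).getLast (by simp)
    let cX := (a :: l).countP (· ∈ X)
    let cY := (a :: l).countP (· ∈ Y)
    (a ∈ X → b ∈ X → cX = cY + 1) ∧ (a ∈ X → b ∈ Y → cX = cY) ∧
    (a ∈ Y → b ∈ X → cX = cY) ∧ (a ∈ Y → b ∈ Y → cY = cX + 1) := by
  have hd : ∀ v, v ∈ X → v ∉ Y := fun v hx hy => Finset.disjoint_left.1 hXY hx hy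
  induction l generalizing a with
  | nil =>
    simp only [List.getLast_singleton, List.countP_singleton]
    refine ⟨?_, ?_, ?_, ?_⟩ <;> intro h1 h2 <;> grind
  | cons d l ih =>
    rw [List.isChain_cons_cons] at h
    obtain ⟨i1, i2, i3, i4⟩ := ih d h.2
    have hd1 := h.1.2
    simp only [Finset.mem_coe] at hd1
    simp only [List.getLast_cons_cons]
    rw [List.countP_cons (a := a), List.countP_cons (a := a)]
    refine ⟨?_, ?_, ?_, ?_⟩ <;> intro h1 h2 <;> grind

lemma IsCycleList.subset_of_between (h : IsCycleList (G.between X Y) l) :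
    ∀ v ∈ l, v ∈ X ∪ Y := by
  intro v hv
  obtain ⟨l₁, l₂, rfl⟩ := List.append_of_mem hv
  have h' := (h.append_comm).2.2 v (by simp)
  obtain ⟨b, hb⟩ : ∃ b, b ∈ ((v :: l₂) ++ l₁).getLast? := by
    exact ⟨_, List.getLast?_eq_some_getLast (by simp)⟩
  have := (h' b hb).2
  simp only [Finset.mem_coe] at this
  grind

lemma IsCycleList.card_inter_eq (hXY : Disjoint X Y) (h : IsCycleList (G.between X Y) l) :
    (l.toFinset ∩ X).card = (l.toFinset ∩ Y).card := by
  rw [card_toFinset_inter h.1, card_toFinset_inter h.1]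
  rcases l with _ | ⟨a, l⟩
  · simp
  have h1 := isChain_between_countP hXY a l h.2.1
  have h2 := (h.2.2 a (by simp) _ (List.getLast?_eq_some_getLast (by simp))).2
  simp only [Finset.mem_coe] at h2
  grind

end Bipartite

section Hamilton

variable {V : Type*} {G : SimpleGraph V} {X Y : Finset V} {l : List V}

lemma isCycleList_reverse_append_append {B : SimpleGraph V} {P Q T : List V} {x y p q₀ q₁ t : V}
    (hnd : (P ++ (Q ++ T)).Nodup) (hP : P.IsChain B.Adj) (hQ : Q.IsChain B.Adj)
    (hT : T.IsChain B.Adj)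
    (hP0 : P.head? = some x) (hP1 : P.getLast? = some p) (hQ0 : Q.head? = some q₀)
    (hQ1 : Q.getLast? = some q₁) (hT0 : T.head? = some t) (hT1 : T.getLast? = some y)
    (h1 : B.Adj x q₀) (h2 : B.Adj q₁ y) (h3 : B.Adj t p) :
    IsCycleList B (P.reverse ++ (Q ++ T.reverse)) := by
  refine ⟨?_, ?_, ?_⟩
  · refine (List.Perm.nodup_iff ?_).1 hnd
    exact (List.reverse_perm P).symm.append ((List.Perm.refl Q).append (List.reverse_perm T).symm)
  · rw [List.isChain_append, List.isChain_append, List.isChain_reverse, List.isChain_reverse]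
    simp only [List.getLast?_reverse, List.head?_append, List.head?_reverse, hP0, hQ0, hQ1, hT1]
    refine ⟨hP.imp fun _ _ h => h.symm, ⟨hQ, hT.imp fun _ _ h => h.symm, ?_⟩, ?_⟩ <;> simp [h1, h2]
  · simp only [List.head?_append, List.head?_reverse, List.getLast?_append, List.getLast?_reverse,
      hP1, hT0]
    simpa using h3

lemma isCycleList_append_reverse_reverse {B : SimpleGraph V} {P Q T : List V} {x y p q₀ q₁ t : V}
    (hnd : (P ++ (Q ++ T)).Nodup) (hP : P.IsChain B.Adj) (hQ : Q.IsChain B.Adj)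
    (hT : T.IsChain B.Adj)
    (hP0 : P.head? = some x) (hP1 : P.getLast? = some p) (hQ0 : Q.head? = some q₀)
    (hQ1 : Q.getLast? = some q₁) (hT0 : T.head? = some t) (hT1 : T.getLast? = some y)
    (h1 : B.Adj y p) (h2 : B.Adj x q₁) (h3 : B.Adj q₀ t) :
    IsCycleList B (T ++ (P.reverse ++ Q.reverse)) := by
  refine ⟨?_, ?_, ?_⟩
  · refine (List.Perm.nodup_iff ?_).1 hnd
    rw [← List.append_assoc]
    exact List.perm_append_comm.trans ((List.Perm.refl T).append
      ((List.reverse_perm P).symm.append (List.reverse_perm Q).symm))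
  · rw [List.isChain_append, List.isChain_append, List.isChain_reverse, List.isChain_reverse]
    simp only [List.getLast?_reverse, List.head?_append, List.head?_reverse, hP0, hQ1, hT1, hP1]
    refine ⟨hT, ⟨hP.imp fun _ _ h => h.symm, hQ.imp fun _ _ h => h.symm, ?_⟩, ?_⟩ <;> simp [h1, h2]
  · simp only [List.head?_append, List.head?_reverse, List.getLast?_append, List.getLast?_reverse,
      hQ0, hT0]
    simpa using h3

lemma exists_card_filter_le_eq (I : Finset ℕ) {h : ℕ} (h1 : 1 ≤ h) (h2 : h ≤ I.card) :
    ∃ t, (I.filter (· ≤ t)).card = h := by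
  obtain ⟨J, hJ, hc⟩ := Finset.exists_subset_card_eq h2
  have hex : ∃ t, h ≤ (I.filter (· ≤ t)).card := by
    refine ⟨I.sup id, ?_⟩
    rw [Finset.filter_true_of_mem]
    · exact h2
    · intro i hi
      exact Finset.le_sup (f := id) hi
  refine ⟨Nat.find hex, le_antisymm ?_ (Nat.find_spec hex)⟩
  rcases ht : Nat.find hex with _ | t
  · calc _ ≤ ({0} : Finset ℕ).card := Finset.card_le_card (by intro i; simp)
      _ ≤ h := by simpa using h1
  · have := Nat.find_min hex (m := t) (by omega)
    refine (Finset.card_le_card (t := insert (t + 1) (I.filter (· ≤ t))) ?_).trans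
      ((Finset.card_insert_le _ _).trans (by omega))
    intro i
    simp only [Finset.mem_filter, Finset.mem_insert]
    grind

/-- A Hamiltonian path of a balanced bipartite graph with large minimum degree and without
large holes can be turned into a Hamiltonian cycle. -/
lemma exists_isCycleList_of_path {h : ℕ} (hXY : Disjoint X Y) (hno : NoHole G X Y h)
    {x y : V} (hxX : x ∈ X) (hyY : y ∈ Y) (hxy : ¬ G.Adj x y)
    (hx : 2 * h ≤ (Y.filter (G.Adj x)).card) (hy : 2 * h ≤ (X.filter (G.Adj y)).card)
    (hnd : l.Nodup) (hch : l.IsChain (G.between X Y).Adj) (hl : l.toFinset = X ∪ Y)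
    (hhd : l.head? = some x) (hlast : l.getLast? = some y) :
    ∃ l', IsCycleList (G.between X Y) l' ∧ l'.toFinset = X ∪ Y := by
  have hd : ∀ v, v ∈ X → v ∉ Y := fun v hx hy => Finset.disjoint_left.1 hXY hx hy
  have h1 : 1 ≤ h := by
    by_contra h0
    obtain ⟨s, hs, -⟩ := hno ∅ (by simp) ∅ (by simp) (by simp; omega) (by simp; omega)
    simp at hs
  have hmem : ∀ v, v ∈ l ↔ v ∈ X ∪ Y := fun v => by rw [← hl, List.mem_toFinset]
  set v : ℕ → V := fun i => l.getD i x with hv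
  set N := l.length with hN
  have hvl : ∀ i (hi : i < N), l[i] = v i := fun i hi => (List.getD_eq_getElem l x hi).symm
  have hvo : ∀ i, i < N → l[i]? = some (v i) := fun i hi => by
    rw [← hvl i hi]; exact List.getElem?_eq_getElem hi
  have hN0 : 0 < N := by
    rcases hl0 : l with _ | ⟨a, l'⟩
    · simp [hl0] at hhd
    · simp [hN, hl0]
  have hv0 : v 0 = x := by
    rw [List.head?_eq_getElem?, hvo 0 hN0] at hhd; simpa using hhd
  have hvN : v (N - 1) = y := by
    rw [List.getLast?_eq_getElem?, hvo _ (by omega)] at hlast; simpa using hlast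
  have hadj : ∀ i, i + 1 < N → (G.between X Y).Adj (v i) (v (i + 1)) := fun i hi => by
    rw [← hvl i (by omega), ← hvl (i + 1) hi]
    exact List.isChain_iff_getElem.1 hch i hi
  have hinj : ∀ i j, i < N → j < N → v i = v j → i = j := fun i j hi hj hij => by
    rw [← hvl i hi, ← hvl j hj] at hij
    exact (hnd.getElem_inj_iff).1 hij
  have hXi : ∀ i, i + 1 < N → v i ∈ X → v (i + 1) ∈ Y := fun i hi hX => by
    have := (hadj i hi).2
    simp only [Finset.mem_coe] at this
    grind
  have hYi : ∀ i, i + 1 < N → v i ∈ Y → v (i + 1) ∈ X := fun i hi hY => by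
    have := (hadj i hi).2
    simp only [Finset.mem_coe] at this
    grind
  have hpr : ∀ i, i + 1 < N → v (i + 1) ∈ Y → v i ∈ X := fun i hi hY => by
    have := (hadj i hi).2
    simp only [Finset.mem_coe] at this
    grind
  have hbt : ∀ a b, a ∈ X → b ∈ Y → G.Adj a b → (G.between X Y).Adj a b := fun a b ha hb hab =>
    ⟨hab, Or.inl ⟨by simpa using ha, by simpa using hb⟩⟩
  have hidx : ∀ u ∈ X ∪ Y, ∃ i < N, v i = u := fun u hu => by
    obtain ⟨i, hi, rfl⟩ := List.getElem_of_mem ((hmem u).2 hu)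
    exact ⟨i, hi, (hvl i hi).symm⟩
  have hcard : ∀ Z ⊆ X ∪ Y, Z.card ≤ ((Finset.range N).filter (v · ∈ Z)).card := fun Z hZ => by
    have : Z ⊆ ((Finset.range N).filter (v · ∈ Z)).image v := by
      intro u hu
      obtain ⟨i, hi, rfl⟩ := hidx u (hZ hu)
      exact Finset.mem_image_of_mem _ (by simpa [hi] using hu)
    exact (Finset.card_le_card this).trans Finset.card_image_le
  have hcut : ∀ i j, 0 < i → i < j → j < N → ∃ P Q T : List V, l = P ++ (Q ++ T) ∧
      P.head? = some x ∧ P.getLast? = some (v (i - 1)) ∧ Q.head? = some (v i) ∧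
      Q.getLast? = some (v (j - 1)) ∧ T.head? = some (v j) ∧ T.getLast? = some y := by
    intro i j hi hij hj
    refine ⟨l.take i, (l.drop i).take (j - i), l.drop j, ?_, ?_, ?_, ?_, ?_, ?_, ?_⟩
    · have : l.drop j = (l.drop i).drop (j - i) := by
        rw [List.drop_drop]; congr 1; omega
      rw [this, List.take_append_drop, List.take_append_drop]
    · rw [List.head?_take, if_neg (by omega)]; exact hhd
    · rw [List.getLast?_take, if_neg (by omega), hvo _ (by omega)]; rfl
    · rw [List.head?_take, if_neg (by omega), List.head?_drop, hvo _ (by omega)]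
    · rw [List.getLast?_take, if_neg (by omega), List.getElem?_drop, hvo _ (by omega)]
      simp only [Option.some_or]; congr 2; omega
    · rw [List.head?_drop, hvo _ hj]
    · rw [List.getLast?_drop, if_neg (by omega)]; exact hlast
  set I := (Finset.range N).filter (v · ∈ Y.filter (G.Adj x)) with hI
  set J := (Finset.range N).filter (v · ∈ X.filter (G.Adj y)) with hJ
  have hIc : 2 * h ≤ I.card := hx.trans (hcard _ ((Finset.filter_subset _ _).trans
    Finset.subset_union_right))
  have hJc : 2 * h ≤ J.card := hy.trans (hcard _ ((Finset.filter_subset _ _).trans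
    Finset.subset_union_left))
  have hI' : ∀ i ∈ I, i + 1 < N ∧ 0 < i ∧ v i ∈ Y ∧ G.Adj x (v i) := by
    intro i hi
    simp only [hI, Finset.mem_filter, Finset.mem_range] at hi
    refine ⟨?_, ?_, hi.2.1, hi.2.2⟩
    · by_contra hc
      have : i = N - 1 := by omega
      rw [this, hvN] at hi
      exact hxy hi.2.2
    · rcases Nat.eq_zero_or_pos i with rfl | h
      · rw [hv0] at hi; exact absurd hi.2.1 (hd x hxX)
      · exact h
  have hJ' : ∀ i ∈ J, i + 1 < N ∧ v i ∈ X ∧ G.Adj y (v i) := by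
    intro i hi
    simp only [hJ, Finset.mem_filter, Finset.mem_range] at hi
    refine ⟨?_, hi.2.1, hi.2.2⟩
    by_contra hc
    have : i = N - 1 := by omega
    rw [this, hvN] at hi
    exact hd _ hi.2.1 hyY
  have hfin : ∀ l' : List V, IsCycleList (G.between X Y) l' → (∀ u, u ∈ l' ↔ u ∈ l) →
      ∃ l', IsCycleList (G.between X Y) l' ∧ l'.toFinset = X ∪ Y := fun l' h1 h2 =>
    ⟨l', h1, by ext u; rw [List.mem_toFinset, h2, hmem]⟩
  obtain ⟨t, ht⟩ := exists_card_filter_le_eq I h1 (by omega)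
  have hI2 : h ≤ (I.filter (fun i => ¬ i ≤ t)).card := by
    have := Finset.card_filter_add_card_filter_not (s := I) (fun i => i ≤ t)
    omega
  have hJ2 := Finset.card_filter_add_card_filter_not (s := J) (fun i => t ≤ i)
  by_cases hc : h ≤ (J.filter (t ≤ ·)).card
  · obtain ⟨s, hs, r, hr, hsr⟩ := hno ((I.filter (· ≤ t)).image fun i => v (i - 1)) (by
        intro u hu
        obtain ⟨i, hi, rfl⟩ := Finset.mem_image.1 hu
        have := hI' i (Finset.mem_filter.1 hi).1
        apply hpr _ (by omega)
        rw [Nat.sub_add_cancel (by omega)]; exact this.2.2.1)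
      ((J.filter (t ≤ ·)).image fun i => v (i + 1)) (by
        intro u hu
        obtain ⟨i, hi, rfl⟩ := Finset.mem_image.1 hu
        have := hJ' i (Finset.mem_filter.1 hi).1
        exact hXi _ this.1 this.2.1)
      (by
        rw [Finset.card_image_of_injOn, ht]
        intro i hi j hj hij
        have h1 := hI' i (Finset.mem_filter.1 hi).1
        have h2 := hI' j (Finset.mem_filter.1 hj).1
        have := hinj _ _ (by omega) (by omega) hij
        omega)
      (by
        rw [Finset.card_image_of_injOn]
        · exact hc
        intro i hi j hj hij
        have h1 := hJ' i (Finset.mem_filter.1 hi).1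
        have h2 := hJ' j (Finset.mem_filter.1 hj).1
        have := hinj _ _ (by omega) (by omega) hij
        omega)
    obtain ⟨i, hi, rfl⟩ := Finset.mem_image.1 hs
    obtain ⟨j, hj, rfl⟩ := Finset.mem_image.1 hr
    obtain ⟨hi, hit⟩ := Finset.mem_filter.1 hi
    obtain ⟨hj, hjt⟩ := Finset.mem_filter.1 hj
    obtain ⟨i1, i2, i3, i4⟩ := hI' i hi
    obtain ⟨j1, j2, j3⟩ := hJ' j hj
    obtain ⟨P, Q, T, rfl, hP0, hP1, hQ0, hQ1, hT0, hT1⟩ := hcut i (j + 1) i2 (by omega) j1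
    rw [List.isChain_append, List.isChain_append] at hch
    refine hfin _ (isCycleList_reverse_append_append hnd hch.1 hch.2.1.1 hch.2.1.2.1 hP0 hP1 hQ0
      hQ1 hT0 hT1 (hbt _ _ hxX i3 i4) ?_ ?_) (by simp)
    · exact hbt _ _ j2 hyY j3.symm
    · refine (hbt _ _ ?_ (hXi _ j1 j2) hsr).symm
      apply hpr _ (by omega)
      rw [Nat.sub_add_cancel (by omega)]; exact i3
  · obtain ⟨r, hr, s, hs, hsr⟩ := hno ((I.filter (fun i => ¬ i ≤ t)).image fun i => v (i + 1)) (by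
        intro u hu
        obtain ⟨i, hi, rfl⟩ := Finset.mem_image.1 hu
        have := hI' i (Finset.mem_filter.1 hi).1
        exact hYi _ this.1 this.2.2.1)
      ((J.filter (fun i => ¬ t ≤ i)).image fun i => v (i + 1)) (by
        intro u hu
        obtain ⟨i, hi, rfl⟩ := Finset.mem_image.1 hu
        have := hJ' i (Finset.mem_filter.1 hi).1
        exact hXi _ this.1 this.2.1)
      (by
        rw [Finset.card_image_of_injOn]
        · exact hI2
        intro i hi j hj hij
        have h1 := hI' i (Finset.mem_filter.1 hi).1
        have h2 := hI' j (Finset.mem_filter.1 hj).1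
        have := hinj _ _ (by omega) (by omega) hij
        omega)
      (by
        rw [Finset.card_image_of_injOn]
        · omega
        intro i hi j hj hij
        have h1 := hJ' i (Finset.mem_filter.1 hi).1
        have h2 := hJ' j (Finset.mem_filter.1 hj).1
        have := hinj _ _ (by omega) (by omega) hij
        omega)
    obtain ⟨i, hi, rfl⟩ := Finset.mem_image.1 hr
    obtain ⟨j, hj, rfl⟩ := Finset.mem_image.1 hs
    obtain ⟨hi, hit⟩ := Finset.mem_filter.1 hi
    obtain ⟨hj, hjt⟩ := Finset.mem_filter.1 hj
    obtain ⟨i1, i2, i3, i4⟩ := hI' i hi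
    obtain ⟨j1, j2, j3⟩ := hJ' j hj
    obtain ⟨P, Q, T, rfl, hP0, hP1, hQ0, hQ1, hT0, hT1⟩ :=
      hcut (j + 1) (i + 1) (by omega) (by omega) i1
    rw [List.isChain_append, List.isChain_append] at hch
    refine hfin _ (isCycleList_append_reverse_reverse hnd hch.1 hch.2.1.1 hch.2.1.2.1 hP0 hP1 hQ0
      hQ1 hT0 hT1 (hbt _ _ j2 hyY j3.symm).symm (hbt _ _ hxX i3 i4)
      (hbt _ _ (hYi _ i1 i3) (hXi _ j1 j2) hsr).symm) ?_
    simp only [List.mem_append, List.mem_reverse]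
    tauto

lemma exists_isCycleList_of_complete (hcard : X.card = Y.card)
    (hc : ∀ x ∈ X, ∀ y ∈ Y, G.Adj x y) :
    ∃ l, IsCycleList (G.between X Y) l ∧ l.toFinset = X ∪ Y := by
  suffices H : ∀ X' ⊆ X, ∀ Y' ⊆ Y, Disjoint X' Y' → X'.card = Y'.card →
      ∃ l : List V, l.Nodup ∧ l.IsChain (G.between X Y).Adj ∧ l.toFinset = X' ∪ Y' ∧
      (∀ a ∈ l.head?, a ∈ X) ∧ (∀ b ∈ l.getLast?, b ∈ Y) by
    have hdis : Disjoint X Y := Finset.disjoint_left.2 fun v hx hy => (hc v hx v hy).ne rfl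
    obtain ⟨l, h1, h2, h3, h4, h5⟩ := H X subset_rfl Y subset_rfl hdis hcard
    exact ⟨l, ⟨h1, h2, fun a ha b hb => ⟨(hc a (h4 a ha) b (h5 b hb)).symm,
      Or.inr ⟨h5 b hb, h4 a ha⟩⟩⟩, h3⟩
  intro X' hX'
  induction X' using Finset.induction_on with
  | empty =>
    intro Y' _ _ h
    exact ⟨[], by simpa [eq_comm] using h⟩
  | insert x X' hx ih =>
    intro Y' hY' hdis hcard
    rw [Finset.card_insert_of_notMem hx] at hcard
    obtain ⟨y, hy⟩ : Y'.Nonempty := by rw [← Finset.card_pos]; omega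
    rw [Finset.disjoint_insert_left] at hdis
    obtain ⟨l, h1, h2, h3, h4, h5⟩ := ih ((Finset.subset_insert _ _).trans hX') (Y'.erase y)
      ((Finset.erase_subset _ _).trans hY') (hdis.2.mono_right (Finset.erase_subset _ _))
      (by rw [Finset.card_erase_of_mem hy]; omega)
    have hxX := hX' (Finset.mem_insert_self _ _)
    have hml : ∀ v, v ∈ l ↔ v ∈ X' ∪ Y'.erase y := fun v => by rw [← h3, List.mem_toFinset]
    have hyX : y ∉ X' := Finset.disjoint_right.1 hdis.2 hy
    refine ⟨x :: y :: l, ?_, ?_, ?_, by simpa using hxX, ?_⟩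
    · simp only [List.nodup_cons, List.mem_cons, hml, Finset.mem_union, Finset.mem_erase]
      grind
    · rw [List.isChain_cons_cons, List.isChain_cons]
      refine ⟨⟨hc x hxX y (hY' hy), Or.inl ⟨hxX, hY' hy⟩⟩, fun a ha => ?_, h2⟩
      exact ⟨(hc a (h4 a ha) y (hY' hy)).symm, Or.inr ⟨hY' hy, h4 a ha⟩⟩
    · ext v
      simp only [List.toFinset_cons, Finset.mem_insert, h3, Finset.mem_union, Finset.mem_erase]
      grind
    · intro b hb
      rcases l with _ | ⟨a, l⟩
      · simp at hb; subst hb; exact hY' hy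
      · exact h5 b (by simpa using hb)

/-- A balanced bipartite graph with large minimum degree and without large holes is
Hamiltonian. -/
theorem exists_hamilton_isCycleList {h : ℕ} (hXY : Disjoint X Y) (hcard : X.card = Y.card)
    (hX : ∀ x ∈ X, 2 * h ≤ (Y.filter (G.Adj x)).card)
    (hY : ∀ y ∈ Y, 2 * h ≤ (X.filter (G.Adj y)).card) (hno : NoHole G X Y h) :
    ∃ l, IsCycleList (G.between X Y) l ∧ l.toFinset = X ∪ Y := by
  have h1 : 1 ≤ h := by
    by_contra h0
    obtain ⟨s, hs, -⟩ := hno ∅ (by simp) ∅ (by simp) (by simp; omega) (by simp; omega)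
    simp at hs
  induction hm : ((X ×ˢ Y).filter fun p => ¬ G.Adj p.1 p.2).card using
    Nat.strong_induction_on generalizing G with
  | _ m ih =>
  by_cases hc : ∀ x ∈ X, ∀ y ∈ Y, G.Adj x y
  · exact exists_isCycleList_of_complete hcard hc
  push Not at hc
  obtain ⟨x, hx, y, hy, hxy⟩ := hc
  have hd : ∀ v, v ∈ X → v ∉ Y := fun v hx hy => Finset.disjoint_left.1 hXY hx hy
  have hne : x ≠ y := fun h => hd x hx (h ▸ hy)
  obtain ⟨G', hG'⟩ : ∃ G', G' = G ⊔ SimpleGraph.edge x y := ⟨_, rfl⟩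
  have hle : G ≤ G' := hG' ▸ le_sup_left
  have hadj : ∀ u v, G'.Adj u v → ¬ (u = x ∧ v = y) → ¬ (u = y ∧ v = x) → G.Adj u v := by
    intro u v huv h1 h2
    rw [hG', SimpleGraph.sup_adj, SimpleGraph.edge_adj] at huv
    tauto
  have hxy' : G'.Adj x y := by
    rw [hG', SimpleGraph.sup_adj, SimpleGraph.edge_adj]
    exact Or.inr ⟨Or.inl ⟨rfl, rfl⟩, hne⟩
  obtain ⟨l, hl, hlX⟩ := ih _ (by
      rw [← hm]
      apply Finset.card_lt_card
      refine (Finset.ssubset_iff_of_subset ?_).2 ⟨(x, y), by simp [hx, hy, hxy], by simp [hxy']⟩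
      intro p
      simp only [Finset.mem_filter]
      exact fun hp => ⟨hp.1, fun h => hp.2 (hle h)⟩) (G := G')
    (fun x hx => (hX x hx).trans (Finset.card_le_card
      (Finset.monotone_filter_right _ fun _ _ h => hle h)))
    (fun y hy => (hY y hy).trans (Finset.card_le_card
      (Finset.monotone_filter_right _ fun _ _ h => hle h)))
    (fun S hS T hT h1 h2 => by
      obtain ⟨s, hs, t, ht, h⟩ := hno S hS T hT h1 h2
      exact ⟨s, hs, t, ht, hle h⟩) rfl
  have hxl : x ∈ l := by rw [← List.mem_toFinset, hlX]; simp [hx]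
  obtain ⟨l₁, l₂, rfl⟩ := List.append_of_mem hxl
  replace hl := hl.append_comm
  have hset : ((x :: (l₂ ++ l₁)) : List V).toFinset = X ∪ Y := by
    rw [← hlX]; ext v; simp; tauto
  rw [List.cons_append] at hl
  set t := l₂ ++ l₁ with ht
  have hBadj : ∀ u v, (G'.between X Y).Adj u v → ¬ (u = x ∧ v = y) → ¬ (u = y ∧ v = x) →
      (G.between X Y).Adj u v := fun u v huv h1 h2 => ⟨hadj u v huv.1 h1 h2, huv.2⟩
  obtain ⟨hnd, hch, hcl⟩ := hl
  rw [List.nodup_cons] at hnd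
  rw [List.isChain_cons] at hch
  have htch : t.IsChain (G.between X Y).Adj := by
    rw [List.isChain_iff_forall_rel_of_append_cons_cons]
    intro a b s₁ s₂ h
    have ha : a ≠ x := by rintro rfl; exact hnd.1 (by rw [h]; simp)
    have hb : b ≠ x := by rintro rfl; exact hnd.1 (by rw [h]; simp)
    exact hBadj _ _ ((List.isChain_iff_forall_rel_of_append_cons_cons.1 hch.2) h) (by tauto)
      (by tauto)
  have htne : t ≠ [] := by
    intro h0
    rw [h0] at hcl
    exact (hcl x (by simp) x (by simp)).ne rfl
  obtain ⟨d, hdt⟩ : ∃ d, t.head? = some d := ⟨_, List.head?_eq_some_head htne⟩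
  obtain ⟨e, het⟩ : ∃ e, t.getLast? = some e := ⟨_, List.getLast?_eq_some_getLast htne⟩
  have hxd := hch.1 d hdt
  have hex : (G'.between X Y).Adj e x := hcl x (by simp) e (by rw [List.getLast?_cons, het]; simp)
  have hdx : d ≠ x := hxd.ne.symm
  by_cases hd' : d = y
  · subst hd'
    by_cases he : e = d
    · subst he
      have : t = [e] := by
        rcases t with _ | ⟨a, t⟩
        · exact absurd rfl htne
        · simp only [List.head?_cons, Option.some.injEq] at hdt
          subst hdt
          rcases t.eq_nil_or_concat with rfl | ⟨t, b, rfl⟩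
          · rfl
          · rw [List.concat_eq_append] at het hnd
            have hb : b = a := by
              rw [← List.cons_append, List.getLast?_append] at het
              simpa using het
            subst hb
            simp at hnd
      rw [this] at hset
      have h3 := hX x hx
      have : Y.filter (G.Adj x) ⊆ {e} := by
        intro v hv
        have hv' := (Finset.mem_filter.1 hv).1
        have : v ∈ X ∪ Y := Finset.mem_union_right _ hv'
        rw [← hset] at this
        simp only [List.toFinset_cons, List.toFinset_nil, Finset.mem_insert] at this
        rcases this with rfl | h
        · exact absurd hv' (hd _ hx)
        · simpa using h
      have := Finset.card_le_card this
      simp at this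
      omega
    · refine exists_isCycleList_of_path hXY hno hx hy hxy (hX x hx) (hY d hy)
        (l := x :: t.reverse) ?_ ?_ ?_ (by simp) ?_
      · rw [List.nodup_cons]; simpa using hnd
      · rw [List.isChain_cons, List.isChain_reverse]
        refine ⟨?_, htch.imp fun _ _ h => h.symm⟩
        rw [List.head?_reverse, het]
        simp only [Option.mem_def, Option.some.injEq, forall_eq']
        exact (hBadj _ _ hex (fun h => hne h.2) (fun h => he h.1)).symm
      · rw [← hset]; ext v; simp
      · rw [List.getLast?_cons, List.getLast?_reverse, hdt]; rfl
  · have hxd' := hBadj _ _ hxd (by tauto) (by tauto)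
    have hcx : (x :: t).IsChain (G.between X Y).Adj := by
      rw [List.isChain_cons]
      refine ⟨?_, htch⟩
      rw [hdt]
      simpa using hxd'
    have hlx : (x :: t).getLast? = some e := by rw [List.getLast?_cons, het]; simp
    by_cases he : e = y
    · subst he
      exact exists_isCycleList_of_path hXY hno hx hy hxy (hX x hx) (hY e hy)
        (l := x :: t) (List.nodup_cons.2 hnd) hcx hset (by simp) hlx
    · refine ⟨x :: t, ⟨List.nodup_cons.2 hnd, hcx, ?_⟩, hset⟩
      rw [hlx]
      simpa using hBadj _ _ hex (fun h => hne h.2) (fun h => he h.1)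

end Hamilton

section DepthFirst

variable {V : Type*} {G : SimpleGraph V} {X Y : Finset V} {l : List V}

lemma countP_of_isChain_between (hXY : Disjoint X Y) (h : l.IsChain (G.between X Y).Adj)
    (hl : ∀ v ∈ l, v ∈ X ∪ Y) :
    l.countP (· ∈ X) ≤ l.countP (· ∈ Y) + 1 ∧ l.countP (· ∈ Y) ≤ l.countP (· ∈ X) + 1 ∧
      l.countP (· ∈ X) + l.countP (· ∈ Y) = l.length := by
  have hlen : l.countP (· ∈ X) + l.countP (· ∈ Y) = l.length := by
    rw [List.length_eq_countP_add_countP (p := fun v => decide (v ∈ X))]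
    congr 1
    refine List.countP_congr fun v hv => ?_
    have := hl v hv
    have : v ∈ X → v ∉ Y := fun h => Finset.disjoint_left.1 hXY h
    simp only [Finset.mem_union] at *
    simp
    tauto
  refine ⟨?_, ?_, hlen⟩
  all_goals
    rcases l with _ | ⟨a, l⟩
    · simp
    · obtain ⟨h1, h2, h3, h4⟩ := isChain_between_countP hXY a l h
      have ha := hl a (by simp)
      have hb := hl _ (List.getLast_mem (List.cons_ne_nil a l))
      simp only [Finset.mem_union] at ha hb
      grind

lemma exists_dfs_state (X Y : Finset V) (m : ℕ) (hm : m ≤ 2 * (X ∪ Y).card) :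
    ∃ (P : List V) (D : Finset V), P.Nodup ∧ P.IsChain (G.between X Y).Adj ∧
      P.toFinset ⊆ X ∪ Y ∧ D ⊆ X ∪ Y ∧ Disjoint D P.toFinset ∧
      (∀ d ∈ D, ∀ u ∈ X ∪ Y, u ∉ D → u ∉ P → ¬ (G.between X Y).Adj d u) ∧
      2 * D.card + P.length = m := by
  induction m with
  | zero => exact ⟨[], ∅, by simp⟩
  | succ m ih =>
    obtain ⟨P, D, h1, h2, h3, h4, h5, h6, h7⟩ := ih (by omega)
    rcases P with _ | ⟨a, P⟩
    · obtain ⟨u, hu, huD⟩ : ∃ u ∈ X ∪ Y, u ∉ D := by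
        by_contra! hc
        have := Finset.card_le_card hc
        simp only [List.length_nil] at h7
        omega
      refine ⟨[u], D, by simp, by simp, by simpa using hu, h4, by simpa using huD, ?_, by
        simp at h7 ⊢; omega⟩
      intro d hd v hv hvD _
      exact h6 d hd v hv hvD (by simp)
    · by_cases hc : ∃ u ∈ X ∪ Y, u ∉ D ∧ u ∉ a :: P ∧ (G.between X Y).Adj a u
      · obtain ⟨u, hu, huD, huP, hau⟩ := hc
        refine ⟨u :: a :: P, D, List.nodup_cons.2 ⟨huP, h1⟩, ?_, ?_, h4, ?_, ?_, by
          simp at h7 ⊢; omega⟩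
        · rw [List.isChain_cons_cons]
          exact ⟨hau.symm, h2⟩
        · rw [List.toFinset_cons]
          exact Finset.insert_subset hu h3
        · rw [List.toFinset_cons, Finset.disjoint_insert_right]
          exact ⟨huD, h5⟩
        · intro d hd v hv hvD hvP
          exact h6 d hd v hv hvD (fun h => hvP (List.mem_cons_of_mem _ h))
      · push Not at hc
        rw [List.toFinset_cons, Finset.disjoint_insert_right] at h5
        rw [List.toFinset_cons, Finset.insert_subset_iff] at h3
        rw [List.nodup_cons] at h1
        refine ⟨P, insert a D, h1.2, h2.of_cons, h3.2, Finset.insert_subset h3.1 h4, ?_, ?_, ?_⟩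
        · rw [Finset.disjoint_insert_left]
          exact ⟨by simpa using h1.1, h5.2⟩
        · intro d hd v hv hvD hvP
          rw [Finset.mem_insert, not_or] at hvD
          rcases Finset.mem_insert.1 hd with rfl | hd
          · exact hc v hv hvD.2 (by simp [hvD.1, hvP])
          · exact h6 d hd v hv hvD.2 (by simp [hvD.1, hvP])
        · rw [Finset.card_insert_of_notMem h5.1]
          simp at h7
          omega

/-- A balanced bipartite graph without large holes has an almost spanning cycle. -/
theorem exists_isCycleList_of_noHole {h : ℕ} (hXY : Disjoint X Y) (hcard : X.card = Y.card)
    (hno : NoHole G X Y h) :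
    ∃ l, IsCycleList (G.between X Y) l ∧ (X \ l.toFinset).card ≤ 4 * h := by
  have hZ : (X ∪ Y).card = X.card + Y.card := Finset.card_union_of_disjoint hXY
  obtain ⟨P, D, h1, h2, h3, h4, h5, h6, h7⟩ := exists_dfs_state (G := G) X Y (2 * X.card) (by omega)
  have hP : ∀ v ∈ P, v ∈ X ∪ Y := fun v hv => h3 (by simpa using hv)
  have hd : ∀ v, v ∈ X → v ∉ Y := fun v hx hy => Finset.disjoint_left.1 hXY hx hy
  obtain ⟨p1, p2, p3⟩ := countP_of_isChain_between hXY h2 hP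
  have hsplit : ∀ W ⊆ X ∪ Y, W.card = (W ∩ D).card + (W ∩ P.toFinset).card +
      (W \ (D ∪ P.toFinset)).card := by
    intro W _
    rw [← Finset.card_inter_add_card_sdiff W (D ∪ P.toFinset), Finset.inter_union_distrib_left,
      Finset.card_union_of_disjoint]
    exact (h5.mono_left Finset.inter_subset_right).mono_right Finset.inter_subset_right
  have hX := hsplit X Finset.subset_union_left
  have hY := hsplit Y Finset.subset_union_right
  rw [Finset.inter_comm X P.toFinset, card_toFinset_inter h1] at hX
  rw [Finset.inter_comm Y P.toFinset, card_toFinset_inter h1] at hY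
  have hD : D.card = (X ∩ D).card + (Y ∩ D).card := by
    rw [← Finset.card_union_of_disjoint, ← Finset.union_inter_distrib_right,
      Finset.inter_eq_right.2 h4]
    exact (hXY.mono_left Finset.inter_subset_left).mono_right Finset.inter_subset_left
  have hn1 : (X ∩ D).card < h ∨ (Y \ (D ∪ P.toFinset)).card < h := by
    by_contra! hc
    obtain ⟨s, hs, t, ht, hst⟩ := hno _ Finset.inter_subset_left _ Finset.sdiff_subset hc.1 hc.2
    simp only [Finset.mem_inter, Finset.mem_sdiff, Finset.mem_union, List.mem_toFinset,
      not_or] at hs ht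
    exact h6 s hs.2 t (Finset.mem_union_right _ ht.1) ht.2.1 ht.2.2
      ⟨hst, Or.inl ⟨hs.1, ht.1⟩⟩
  have hn2 : (X \ (D ∪ P.toFinset)).card < h ∨ (Y ∩ D).card < h := by
    by_contra! hc
    obtain ⟨s, hs, t, ht, hst⟩ := hno _ Finset.sdiff_subset _ Finset.inter_subset_left hc.1 hc.2
    simp only [Finset.mem_inter, Finset.mem_sdiff, Finset.mem_union, List.mem_toFinset,
      not_or] at hs ht
    exact h6 t ht.2 s (Finset.mem_union_left _ hs.1) hs.2.1 hs.2.2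
      ⟨hst.symm, Or.inr ⟨ht.1, hs.1⟩⟩
  by_cases hlen : P.length < 4 * h
  · refine ⟨[], IsCycleList.nil, ?_⟩
    simp
    omega
  have hh : 0 < h := by
    rcases Nat.eq_zero_or_pos h with rfl | h
    · simp at hn1
    · exact h
  obtain ⟨A, M, C, hPe, hA, hC⟩ : ∃ A M C : List V, P = A ++ (M ++ C) ∧ A.length = 2 * h ∧
      C.length = 2 * h := by
    refine ⟨P.take (2 * h), (P.drop (2 * h)).take (P.length - 4 * h),
      (P.drop (2 * h)).drop (P.length - 4 * h), ?_, ?_, ?_⟩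
    · rw [List.take_append_drop, List.take_append_drop]
    · rw [List.length_take]; omega
    · rw [List.length_drop, List.length_drop]; omega
  rw [hPe, List.isChain_append, List.isChain_append] at h2
  obtain ⟨a1, a2, a3⟩ := countP_of_isChain_between hXY h2.1 (fun v hv => hP v (by simp [hPe, hv]))
  obtain ⟨c1, c2, c3⟩ := countP_of_isChain_between hXY h2.2.1.2.1
    (fun v hv => hP v (by simp [hPe, hv]))
  have hnd := h1
  rw [hPe, List.nodup_append, List.nodup_append] at hnd
  obtain ⟨x, hx, y, hy, hxy⟩ := hno (A.toFinset ∩ X) Finset.inter_subset_right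
    (C.toFinset ∩ Y) Finset.inter_subset_right
    (by rw [card_toFinset_inter hnd.1]; omega) (by rw [card_toFinset_inter hnd.2.1.2.1]; omega)
  simp only [Finset.mem_inter, List.mem_toFinset] at hx hy
  obtain ⟨A₁, A₂, hAe⟩ := List.append_of_mem hx.1
  obtain ⟨C₁, C₂, hCe⟩ := List.append_of_mem hy.1
  have hinf : (x :: (A₂ ++ M ++ C₁)) ++ [y] <:+: P := by
    rw [hPe, hAe, hCe]
    exact ⟨A₁, C₂, by simp⟩
  have hch : P.IsChain (G.between X Y).Adj := by
    rw [hPe, List.isChain_append, List.isChain_append]; exact h2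
  refine ⟨(x :: (A₂ ++ M ++ C₁)) ++ [y], ⟨h1.sublist hinf.sublist, hch.infix hinf, ?_⟩, ?_⟩
  · intro a ha b hb
    rw [List.cons_append, List.head?_cons, Option.mem_def, Option.some.injEq] at ha
    rw [List.getLast?_append, List.getLast?_singleton] at hb
    have hb : y = b := by simpa using hb
    subst ha hb
    exact ⟨hxy.symm, Or.inr ⟨hy.2, hx.2⟩⟩
  · have hsub : X \ ((x :: (A₂ ++ M ++ C₁)) ++ [y]).toFinset ⊆
        ((X ∩ D) ∪ (X \ (D ∪ P.toFinset))) ∪ ((A.toFinset ∩ X) ∪ (C.toFinset ∩ X)) := by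
      intro v hv
      obtain ⟨hvX, hvl⟩ := Finset.mem_sdiff.1 hv
      rw [Finset.mem_union, Finset.mem_union, Finset.mem_union]
      by_cases hvD : v ∈ D
      · exact Or.inl (Or.inl (Finset.mem_inter.2 ⟨hvX, hvD⟩))
      by_cases hvP : v ∈ P
      · rw [hPe, List.mem_append, List.mem_append] at hvP
        rcases hvP with h | h | h
        · exact Or.inr (Or.inl (Finset.mem_inter.2 ⟨List.mem_toFinset.2 h, hvX⟩))
        · exact absurd (List.mem_toFinset.2 (by simp [h])) hvl
        · exact Or.inr (Or.inr (Finset.mem_inter.2 ⟨List.mem_toFinset.2 h, hvX⟩))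
      · refine Or.inl (Or.inr (Finset.mem_sdiff.2 ⟨hvX, fun h => ?_⟩))
        rcases Finset.mem_union.1 h with h | h
        · exact hvD h
        · exact hvP (List.mem_toFinset.1 h)
    have u1 := Finset.card_le_card hsub
    have u2 := Finset.card_union_le ((X ∩ D) ∪ (X \ (D ∪ P.toFinset)))
      ((A.toFinset ∩ X) ∪ (C.toFinset ∩ X))
    have u3 := Finset.card_union_le (X ∩ D) (X \ (D ∪ P.toFinset))
    have u4 := Finset.card_union_le (A.toFinset ∩ X) (C.toFinset ∩ X)
    rw [card_toFinset_inter hnd.1, card_toFinset_inter hnd.2.1.2.1] at u4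
    omega

end DepthFirst

section Bicliques

variable {V : Type*}

/-- `Ds` lists the pairs of classes of pairwise disjoint complete bipartite subgraphs of `G`
between `P` and `Q`, all of whose classes have size `h`. -/
def IsBicliqueFamily (G : SimpleGraph V) (P Q : Finset V) (h : ℕ)
    (Ds : List (Finset V × Finset V)) : Prop :=
  (∀ D ∈ Ds, D.1 ⊆ P ∧ D.2 ⊆ Q ∧ D.1.card = h ∧ D.2.card = h ∧
    ∀ s ∈ D.1, ∀ t ∈ D.2, G.Adj s t) ∧
  Ds.Pairwise fun D D' => Disjoint D.1 D'.1 ∧ Disjoint D.2 D'.2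

/-- After deleting any `M` vertices, some vertex of `C` still has a neighbour in `D.2` and a
different one in `D'.2`. -/
def Linked (G : SimpleGraph V) (C : Finset V) (M : ℕ) (D D' : Finset V × Finset V) : Prop :=
  ∀ F : Finset V, F.card ≤ M → ∃ q ∈ D.2 \ F, ∃ q' ∈ D'.2 \ F, q ≠ q' ∧
    ∃ p ∈ C \ F, G.Adj p q ∧ G.Adj p q'

variable {G : SimpleGraph V} {P Q : Finset V} {h : ℕ} {Ds : List (Finset V × Finset V)}

lemma IsBicliqueFamily.of_cons {D : Finset V × Finset V}
    (hD : IsBicliqueFamily G P Q h (D :: Ds)) : IsBicliqueFamily G P Q h Ds :=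
  ⟨fun D' h' => hD.1 D' (List.mem_cons_of_mem _ h'), (List.pairwise_cons.1 hD.2).2⟩

lemma IsBicliqueFamily.mono {P' Q' : Finset V} (hD : IsBicliqueFamily G P Q h Ds)
    (hP : P ⊆ P') (hQ : Q ⊆ Q') : IsBicliqueFamily G P' Q' h Ds :=
  ⟨fun D h' => ⟨(hD.1 D h').1.trans hP, (hD.1 D h').2.1.trans hQ, (hD.1 D h').2.2⟩, hD.2⟩

lemma IsBicliqueFamily.filter (hD : IsBicliqueFamily G P Q h Ds)
    (p : Finset V × Finset V → Prop) : IsBicliqueFamily G P Q h (Ds.filter (p ·)) :=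
  ⟨fun D h' => hD.1 D (List.mem_filter.1 h').1, hD.2.filter _⟩

lemma IsBicliqueFamily.length_mul_le (hD : IsBicliqueFamily G P Q h Ds) :
    Ds.length * h ≤ P.card := by
  induction Ds generalizing P with
  | nil => simp
  | cons D Ds ih =>
    obtain ⟨h1, -, h2, -⟩ := hD.1 D (by simp)
    have hP := List.pairwise_cons.1 hD.2
    have := ih (P := P \ D.1) ⟨fun D' h' => ⟨?_, (hD.1 D' (by simp [h'])).2⟩, hP.2⟩
    · rw [Finset.card_sdiff_of_subset h1] at this
      have := Finset.card_le_card h1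
      rw [List.length_cons, Nat.add_mul]
      omega
    · rw [Finset.subset_sdiff]
      exact ⟨(hD.1 D' (by simp [h'])).1, (hP.1 D' h').1.symm⟩

lemma exists_maximal_isBicliqueFamily (G : SimpleGraph V) (P Q : Finset V) (hh : 0 < h) :
    ∃ Ds, IsBicliqueFamily G P Q h Ds ∧ ∀ S ⊆ P, ∀ T ⊆ Q,
      (∀ D ∈ Ds, Disjoint S D.1 ∧ Disjoint T D.2) → h ≤ S.card → h ≤ T.card →
      ∃ s ∈ S, ∃ t ∈ T, ¬ G.Adj s t := by
  by_contra! hc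
  have key : ∀ n, ∃ Ds, IsBicliqueFamily G P Q h Ds ∧ Ds.length = n := by
    intro n
    induction n with
    | zero => exact ⟨[], ⟨by simp, by simp⟩, rfl⟩
    | succ n ih =>
      obtain ⟨Ds, hD, hn⟩ := ih
      obtain ⟨S, hS, T, hT, hdis, hSc, hTc, hadj⟩ := hc Ds hD
      obtain ⟨S', hS', hSc'⟩ := Finset.exists_subset_card_eq hSc
      obtain ⟨T', hT', hTc'⟩ := Finset.exists_subset_card_eq hTc
      refine ⟨(S', T') :: Ds, ⟨?_, ?_⟩, by simp [hn]⟩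
      · intro D hD'
        rcases List.mem_cons.1 hD' with rfl | hD'
        · exact ⟨hS'.trans hS, hT'.trans hT, hSc', hTc', fun s hs t ht =>
            hadj s (hS' hs) t (hT' ht)⟩
        · exact hD.1 D hD'
      · refine List.pairwise_cons.2 ⟨fun D hD' => ?_, hD.2⟩
        exact ⟨(hdis D hD').1.mono_left hS', (hdis D hD').2.mono_left hT'⟩
  obtain ⟨Ds, hD, hn⟩ := key (P.card + 1)
  have := hD.length_mul_le
  rw [hn] at this
  nlinarith

lemma exists_path_of_biclique {S T : Finset V} (hS : S ⊆ P) (hT : T ⊆ Q) (hPQ : Disjoint P Q)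
    (hcard : S.card = T.card) {n o : V} (hn : n ∈ Q) (hnT : n ∉ T) (ho : o ∈ T)
    (hadj : ∀ s ∈ S, ∀ t ∈ insert n T, G.Adj s t) :
    ∃ l : List V, (n :: l).Nodup ∧ (n :: l).IsChain (G.between P Q).Adj ∧
      l.getLast? = some o ∧ l.toFinset = S ∪ T := by
  obtain ⟨l, hl, hlt⟩ := exists_isCycleList_of_complete hcard
    (fun s hs t ht => hadj s hs t (Finset.mem_insert_of_mem ht))
  have hol : o ∈ l := by rw [← List.mem_toFinset, hlt]; exact Finset.mem_union_right _ ho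
  have hdis : ∀ v, v ∈ P → v ∉ Q := fun v hx hy => Finset.disjoint_left.1 hPQ hx hy
  obtain ⟨l₁, l₂, rfl⟩ := List.append_of_mem hol
  rw [← List.singleton_append, ← List.append_assoc] at hl
  have hl' := hl.append_comm
  obtain ⟨h1, h2, h3⟩ := hl'
  set m := l₂ ++ (l₁ ++ [o]) with hm
  have hmt : m.toFinset = S ∪ T := by
    rw [← hlt]; ext v; simp [hm]; tauto
  have hlast : m.getLast? = some o := by
    rw [hm, List.getLast?_append, List.getLast?_append]; simp
  refine ⟨m, ?_, ?_, hlast, hmt⟩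
  · rw [List.nodup_cons]
    refine ⟨?_, h1⟩
    rw [← List.mem_toFinset, hmt, Finset.mem_union, not_or]
    exact ⟨fun h => hdis n (hS h) hn, hnT⟩
  · rw [List.isChain_cons]
    constructor
    · intro y hy
      have := (h3 y hy o hlast).2
      simp only [Finset.mem_coe] at this
      have hyS : y ∈ S := by
        rcases this with h | h
        · exact absurd (hT ho) (hdis o (hS h.1))
        · exact h.2
      exact ⟨(hadj y hyS n (Finset.mem_insert_self _ _)).symm, Or.inr ⟨hn, hS hyS⟩⟩
    · refine h2.imp fun a b hab => ⟨hab.1, ?_⟩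
      have := hab.2
      simp only [Finset.mem_coe] at this ⊢
      exact this.imp (fun h => ⟨hS h.1, hT h.2⟩) (fun h => ⟨hT h.1, hS h.2⟩)

lemma exists_path_of_bicliqueFamily {C : Finset V} {M : ℕ} (hPQ : Disjoint P Q) (hC : C ⊆ P)
    (hM : M < h) (L : Finset V × Finset V) (o : V) (hoL : o ∈ L.2)
    (Ds : List (Finset V × Finset V)) (D : Finset V × Finset V)
    (hL : (D :: Ds).getLast? = some L) (hD : IsBicliqueFamily G P Q h (D :: Ds))
    (hlink : ∀ D₁ ∈ D :: Ds, ∀ D₂ ∈ D :: Ds, Linked G C M D₁ D₂)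
    (F : Finset V) (n : V) (hnF : n ∈ F) (hoF : o ∈ F) (hnD : n ∈ D.2) (hno : n ≠ o)
    (hF : F.card + 4 * Ds.length ≤ M) :
    ∃ (l : List V) (K : Finset V), (n :: l).Nodup ∧ (n :: l).IsChain (G.between P Q).Adj ∧
      l.getLast? = some o ∧ (∀ v ∈ l, v ∈ F → v = o) ∧ K ⊆ C ∧ K.card ≤ Ds.length ∧
      (∀ v ∈ l, v ∈ K ∨ ∃ D' ∈ D :: Ds, v ∈ D'.1 ∨ v ∈ D'.2) ∧
      (∀ D' ∈ D :: Ds, (D'.1 \ l.toFinset).card ≤ M ∧ (D'.2 \ l.toFinset).card ≤ M) := by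
  have hdis : ∀ v, v ∈ P → v ∉ Q := fun v hx hy => Finset.disjoint_left.1 hPQ hx hy
  have hsel : ∀ (E : Finset V × Finset V) (W : Finset V) (e : V), E.1.card = h → E.2.card = h →
      W.card ≤ M → e ∈ E.2 → e ∈ W → ∃ S ⊆ E.1, ∃ T ⊆ E.2, S.card = T.card ∧ e ∈ T ∧
      Disjoint S W ∧ (∀ v ∈ T, v ∈ W → v = e) ∧
      (E.1 \ S).card ≤ M ∧ (E.2 \ T).card ≤ M := by
    intro E W e h1 h2 hW he heW
    obtain ⟨S, hS, hSc⟩ := Finset.exists_subset_card_eq (s := E.1 \ W) (n := h - M) (by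
      have := Finset.le_card_sdiff W E.1; omega)
    obtain ⟨T, hT, hTc⟩ := Finset.exists_subset_card_eq (s := E.2 \ W) (n := h - M - 1) (by
      have := Finset.le_card_sdiff W E.2; omega)
    have heT : e ∉ T := fun h => (Finset.mem_sdiff.1 (hT h)).2 heW
    have hTc' : (insert e T).card = h - M := by rw [Finset.card_insert_of_notMem heT]; omega
    have hS' := hS.trans Finset.sdiff_subset
    have hT' : insert e T ⊆ E.2 := Finset.insert_subset he (hT.trans Finset.sdiff_subset)
    refine ⟨S, hS', insert e T, hT', by omega, Finset.mem_insert_self _ _, ?_, ?_, ?_, ?_⟩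
    · exact Finset.disjoint_left.2 fun v hv => (Finset.mem_sdiff.1 (hS hv)).2
    · intro v hv hvW
      rcases Finset.mem_insert.1 hv with h | h
      · exact h
      · exact absurd hvW (Finset.mem_sdiff.1 (hT h)).2
    · rw [Finset.card_sdiff_of_subset hS']; omega
    · rw [Finset.card_sdiff_of_subset hT']; omega
  induction Ds generalizing D F n with
  | nil =>
    simp only [List.getLast?_singleton, Option.some.injEq] at hL
    subst hL
    obtain ⟨e1, e2, e3, e4, e5⟩ := hD.1 D (by simp)
    obtain ⟨S, hS, T, hT, hST, hoT, hSF, hTF, m1, m2⟩ := hsel D F o e3 e4 (by omega) hoL hoF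
    obtain ⟨l, l1, l2, l3, l4⟩ := exists_path_of_biclique (G := G) (hS.trans e1) (hT.trans e2) hPQ
      hST (e2 hnD) (fun h => hno (hTF n h hnF)) hoT (fun s hs t ht => by
        rcases Finset.mem_insert.1 ht with rfl | ht
        · exact e5 s (hS hs) _ hnD
        · exact e5 s (hS hs) t (hT ht))
    have hml : ∀ v, v ∈ l ↔ v ∈ S ∨ v ∈ T := fun v => by
      rw [← List.mem_toFinset, l4, Finset.mem_union]
    refine ⟨l, ∅, l1, l2, l3, ?_, by simp, by simp, ?_, ?_⟩
    · intro v hv hvF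
      rcases (hml v).1 hv with h | h
      · exact absurd hvF (Finset.disjoint_left.1 hSF h)
      · exact hTF v h hvF
    · intro v hv
      refine Or.inr ⟨D, by simp, ?_⟩
      exact ((hml v).1 hv).imp (fun h => hS h) (fun h => hT h)
    · intro D' hD'
      rw [List.mem_singleton] at hD'
      subst hD'
      rw [l4]
      exact ⟨(Finset.card_le_card (Finset.sdiff_subset_sdiff subset_rfl
        Finset.subset_union_left)).trans m1, (Finset.card_le_card (Finset.sdiff_subset_sdiff
        subset_rfl Finset.subset_union_right)).trans m2⟩
  | cons D' Ds ih =>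
    rw [List.length_cons] at hF
    obtain ⟨q, hq, n', hn', hqn, p, hp, hpq, hpn⟩ := hlink D (by simp) D' (by simp) F (by omega)
    rw [Finset.mem_sdiff] at hq hn' hp
    have hF'c : (insert q (insert n' (insert p F))).card ≤ F.card + 3 := by
      refine (Finset.card_insert_le _ _).trans (Nat.succ_le_succ ?_)
      refine (Finset.card_insert_le _ _).trans (Nat.succ_le_succ ?_)
      exact Finset.card_insert_le _ _
    set F' := insert q (insert n' (insert p F)) with hF'
    have hFF' : F ⊆ F' := fun v hv => by simp [hF', hv]
    obtain ⟨l, K, l1, l2, l3, l4, k1, k2, l5, l6⟩ := ih D' (by simpa using hL) hD.of_cons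
      (fun D₁ h₁ D₂ h₂ => hlink D₁ (List.mem_cons_of_mem _ h₁) D₂ (List.mem_cons_of_mem _ h₂))
      F' n' (by simp [hF']) (hFF' hoF) hn'.1 (by rintro rfl; exact hn'.2 hoF) (by omega)
    obtain ⟨e1, e2, e3, e4, e5⟩ := hD.1 D (by simp)
    have hWc : (F' ∪ K).card ≤ M := (Finset.card_union_le _ _).trans (by omega)
    have hqF' : q ∈ F' := by simp [hF']
    have hnF' : n ∈ F' := hFF' hnF
    obtain ⟨S, hS, T, hT, hST, hqT, hSW, hTW, m1, m2⟩ := hsel D (F' ∪ K) q e3 e4 hWc hq.1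
      (Finset.mem_union_left _ hqF')
    have hnq : n ≠ q := by rintro rfl; exact hq.2 hnF
    obtain ⟨r, r1, r2, r3, r4⟩ := exists_path_of_biclique (G := G) (hS.trans e1) (hT.trans e2) hPQ
      hST (e2 hnD) (fun h => hnq (hTW n h (Finset.mem_union_left _ hnF'))) hqT
      (fun s hs t ht => by
        rcases Finset.mem_insert.1 ht with rfl | ht
        · exact e5 s (hS hs) _ hnD
        · exact e5 s (hS hs) t (hT ht))
    have hmr : ∀ v, v ∈ r ↔ v ∈ S ∨ v ∈ T := fun v => by
      rw [← List.mem_toFinset, r4, Finset.mem_union]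
    have hpC := hC hp.1
    have hn'Q : n' ∈ Q := (hD.1 D' (by simp)).2.1 hn'.1
    have hpair := (List.pairwise_cons.1 hD.2).1
    have hoq : o ≠ q := by rintro rfl; exact hq.2 hoF
    have hpF' : p ∈ F' := by simp [hF']
    have hn'F' : n' ∈ F' := by simp [hF']
    have hoQ : o ∈ Q := (hD.1 L (List.mem_of_getLast? hL)).2.1 hoL
    have hnQ := e2 hnD
    have hnotl : ∀ v, v ∈ n :: r → v ∉ l := by
      intro v hv hvl
      by_cases hvF : v ∈ F'
      · have hvo := l4 v hvl hvF
        subst hvo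
        rcases List.mem_cons.1 hv with h | h
        · exact hno h.symm
        · rcases (hmr v).1 h with h | h
          · exact hdis _ (e1 (hS h)) hoQ
          · exact hoq (hTW v h (Finset.mem_union_left _ hvF))
      · have hvr : v ∈ r := by
          rcases List.mem_cons.1 hv with rfl | h
          · exact absurd hnF' hvF
          · exact h
        rcases (hmr v).1 hvr with h | h
        · rcases l5 v hvl with hK | ⟨E, hE, hE' | hE'⟩
          · exact Finset.disjoint_left.1 hSW h (Finset.mem_union_right _ hK)
          · exact Finset.disjoint_left.1 (hpair E hE).1 (hS h) hE'
          · exact hdis _ (e1 (hS h)) ((hD.1 E (List.mem_cons_of_mem _ hE)).2.1 hE')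
        · rcases l5 v hvl with hK | ⟨E, hE, hE' | hE'⟩
          · exact hdis _ (hC (k1 hK)) (e2 (hT h))
          · exact hdis _ ((hD.1 E (List.mem_cons_of_mem _ hE)).1 hE') (e2 (hT h))
          · exact Finset.disjoint_left.1 (hpair E hE).2 (hT h) hE'
    have hpr : p ∉ n :: r := by
      intro h
      rcases List.mem_cons.1 h with h | h
      · exact hdis p hpC (h ▸ hnQ)
      · rcases (hmr p).1 h with h | h
        · exact Finset.disjoint_left.1 hSW h (Finset.mem_union_left _ hpF')
        · exact hdis p hpC (e2 (hT h))
    have hn'r : n' ∉ n :: r := by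
      intro h
      rcases List.mem_cons.1 h with h | h
      · exact hn'.2 (h ▸ hnF)
      · rcases (hmr n').1 h with h | h
        · exact hdis _ (e1 (hS h)) hn'Q
        · exact hqn (hTW n' h (Finset.mem_union_left _ hn'F')).symm
    have hpn' : p ∉ n' :: l := by
      intro h
      rcases List.mem_cons.1 h with h | h
      · exact hpn.ne h
      · exact hdis p hpC (l4 p h hpF' ▸ hoQ)
    have hlast : (n :: r).getLast? = some q := by rw [List.getLast?_cons, r3]; simp
    refine ⟨r ++ p :: n' :: l, insert p K, ?_, ?_, ?_, ?_, ?_, ?_, ?_, ?_⟩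
    · rw [← List.cons_append, List.nodup_append]
      refine ⟨r1, List.nodup_cons.2 ⟨hpn', l1⟩, ?_⟩
      rintro a ha b hb rfl
      rcases List.mem_cons.1 hb with rfl | hb
      · exact hpr ha
      rcases List.mem_cons.1 hb with rfl | hb
      · exact hn'r ha
      · exact hnotl a ha hb
    · rw [← List.cons_append, List.isChain_append, List.isChain_cons_cons, hlast]
      refine ⟨r2, ⟨⟨hpn, Or.inl ⟨hpC, hn'Q⟩⟩, l2⟩, ?_⟩
      simp only [Option.mem_def, Option.some.injEq, List.head?_cons]
      rintro _ rfl _ rfl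
      exact ⟨hpq.symm, Or.inr ⟨e2 hq.1, hpC⟩⟩
    · rw [List.getLast?_append, List.getLast?_cons, List.getLast?_cons, l3]; simp
    · intro v hv hvF
      rw [List.mem_append, List.mem_cons, List.mem_cons] at hv
      rcases hv with hv | rfl | rfl | hv
      · rcases (hmr v).1 hv with h | h
        · exact absurd (Finset.mem_union_left _ (hFF' hvF)) (Finset.disjoint_left.1 hSW h)
        · have := hTW v h (Finset.mem_union_left _ (hFF' hvF))
          exact absurd (this ▸ hvF) hq.2
      · exact absurd hvF hp.2
      · exact absurd hvF hn'.2
      · exact l4 v hv (hFF' hvF)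
    · exact Finset.insert_subset hp.1 k1
    · rw [List.length_cons]
      exact (Finset.card_insert_le _ _).trans (Nat.succ_le_succ k2)
    · intro v hv
      rw [List.mem_append, List.mem_cons, List.mem_cons] at hv
      rcases hv with hv | rfl | rfl | hv
      · exact Or.inr ⟨D, by simp, ((hmr v).1 hv).imp (fun h => hS h) (fun h => hT h)⟩
      · exact Or.inl (Finset.mem_insert_self _ _)
      · exact Or.inr ⟨D', by simp, Or.inr hn'.1⟩
      · rcases l5 v hv with h | ⟨E, hE, h⟩
        · exact Or.inl (Finset.mem_insert_of_mem h)
        · exact Or.inr ⟨E, List.mem_cons_of_mem _ hE, h⟩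
    · intro E hE
      have hsubr : S ∪ T ⊆ (r ++ p :: n' :: l).toFinset := by
        rw [← r4]; intro v; simp; tauto
      have hsubl : l.toFinset ⊆ (r ++ p :: n' :: l).toFinset := by
        intro v; simp; tauto
      rcases List.mem_cons.1 hE with rfl | hE
      · exact ⟨(Finset.card_le_card (Finset.sdiff_subset_sdiff subset_rfl
          (Finset.subset_union_left.trans hsubr))).trans m1, (Finset.card_le_card
          (Finset.sdiff_subset_sdiff subset_rfl
          (Finset.subset_union_right.trans hsubr))).trans m2⟩
      · exact ⟨(Finset.card_le_card (Finset.sdiff_subset_sdiff subset_rfl hsubl)).trans (l6 E hE).1,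
          (Finset.card_le_card (Finset.sdiff_subset_sdiff subset_rfl hsubl)).trans (l6 E hE).2⟩

/-- Pairwise linked bicliques can be almost covered by a single cycle. -/
theorem exists_isCycleList_of_linked {C : Finset V} {M : ℕ} (hPQ : Disjoint P Q) (hC : C ⊆ P)
    (hM : M < h) (hMl : 4 * Ds.length ≤ M) (hD : IsBicliqueFamily G P Q h Ds)
    (hlink : ∀ D₁ ∈ Ds, ∀ D₂ ∈ Ds, Linked G C M D₁ D₂) :
    ∃ l, IsCycleList (G.between P Q) l ∧
      (∀ v ∈ l, v ∈ C ∨ ∃ D ∈ Ds, v ∈ D.1 ∨ v ∈ D.2) ∧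
      (∀ D ∈ Ds, (D.1 \ l.toFinset).card ≤ M ∧ (D.2 \ l.toFinset).card ≤ M) := by
  rcases Ds with _ | ⟨D, Ds⟩
  · exact ⟨[], IsCycleList.nil, by simp⟩
  obtain ⟨L, hL⟩ : ∃ L, (D :: Ds).getLast? = some L :=
    ⟨_, List.getLast?_eq_some_getLast (by simp)⟩
  have hLm := List.mem_of_getLast? hL
  obtain ⟨o, ho, n, hn, hon, p, hp, hpo, hpn⟩ := hlink L hLm D (by simp) ∅ (by simp)
  rw [Finset.sdiff_empty] at ho hn hp
  rw [List.length_cons] at hMl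
  have hpP := hC hp
  have hnQ := (hD.1 D (by simp)).2.1 hn
  have hoQ := (hD.1 L hLm).2.1 ho
  obtain ⟨l, K, l1, l2, l3, l4, k1, k2, l5, l6⟩ := exists_path_of_bicliqueFamily hPQ hC hM L o ho
    Ds D hL hD hlink {n, o, p} n (by simp) (by simp) hn hon.symm (by
      have := Finset.card_le_three (a := n) (b := o) (c := p)
      omega)
  refine ⟨p :: n :: l, ⟨?_, ?_, ?_⟩, ?_, ?_⟩
  · rw [List.nodup_cons]
    refine ⟨fun h => ?_, l1⟩
    rcases List.mem_cons.1 h with h | h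
    · exact hpn.ne h
    · exact hpo.ne (l4 p h (by simp))
  · rw [List.isChain_cons_cons]
    exact ⟨⟨hpn, Or.inl ⟨hpP, hnQ⟩⟩, l2⟩
  · rw [List.getLast?_cons, List.getLast?_cons, l3]
    simp only [List.head?_cons, Option.mem_def, Option.some.injEq, Option.getD_some]
    rintro _ rfl _ rfl
    exact ⟨hpo.symm, Or.inr ⟨hoQ, hpP⟩⟩
  · intro v hv
    rw [List.mem_cons, List.mem_cons] at hv
    rcases hv with rfl | rfl | hv
    · exact Or.inl hp
    · exact Or.inr ⟨D, by simp, Or.inr hn⟩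
    · exact (l5 v hv).imp (fun h => k1 h) id
  · intro E hE
    have hsubl : l.toFinset ⊆ (p :: n :: l).toFinset := by intro v; simp; tauto
    exact ⟨(Finset.card_le_card (Finset.sdiff_subset_sdiff subset_rfl hsubl)).trans (l6 E hE).1,
      (Finset.card_le_card (Finset.sdiff_subset_sdiff subset_rfl hsubl)).trans (l6 E hE).2⟩

end Bicliques

section AlmostCover

variable {V : Type*} {H : Bool → SimpleGraph V} {X Y : Finset V}

/-- `ls` lists pairwise disjoint monochromatic cycles of the bipartite graph between `X` and
`Y`, where `H b` is the graph of the edges of colour `b`. -/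
def IsCyclePacking (H : Bool → SimpleGraph V) (X Y : Finset V) (ls : List (List V)) : Prop :=
  ls.flatten.Nodup ∧ ∀ l ∈ ls, ∃ b, IsCycleList ((H b).between X Y) l

lemma IsCyclePacking.card_inter_eq (hXY : Disjoint X Y) {ls : List (List V)}
    (h : IsCyclePacking H X Y ls) :
    (ls.flatten.toFinset ∩ X).card = (ls.flatten.toFinset ∩ Y).card := by
  obtain ⟨h1, h2⟩ := h
  rw [card_toFinset_inter h1, card_toFinset_inter h1]
  clear h1
  induction ls with
  | nil => simp
  | cons l ls ih =>
    rw [List.flatten_cons, List.countP_append, List.countP_append,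
      ih fun l' hl' => h2 l' (List.mem_cons_of_mem _ hl')]
    obtain ⟨b, hb⟩ := h2 l (by simp)
    have := hb.card_inter_eq hXY
    rw [card_toFinset_inter hb.1, card_toFinset_inter hb.1] at this
    rw [this]

lemma IsCyclePacking.card_sdiff_eq (hXY : Disjoint X Y) (hcard : X.card = Y.card)
    {ls : List (List V)} (h : IsCyclePacking H X Y ls) :
    (X \ ls.flatten.toFinset).card = (Y \ ls.flatten.toFinset).card := by
  have := h.card_inter_eq hXY
  have h1 := Finset.card_sdiff_add_card_inter X ls.flatten.toFinset
  have h2 := Finset.card_sdiff_add_card_inter Y ls.flatten.toFinset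
  rw [Finset.inter_comm] at h1 h2
  omega

lemma IsCyclePacking.subset {ls : List (List V)} (h : IsCyclePacking H X Y ls) :
    ls.flatten.toFinset ⊆ X ∪ Y := by
  intro v hv
  rw [List.mem_toFinset, List.mem_flatten] at hv
  obtain ⟨l, hl, hv⟩ := hv
  obtain ⟨b, hb⟩ := h.2 l hl
  exact hb.subset_of_between v hv

lemma IsCyclePacking.mono {X' Y' : Finset V} (hX : X ⊆ X') (hY : Y ⊆ Y') {ls : List (List V)}
    (h : IsCyclePacking H X Y ls) : IsCyclePacking H X' Y' ls :=
  ⟨h.1, fun l hl => (h.2 l hl).imp fun b hb => hb.mono fun u v (huv : ((H b).between X Y).Adj u v) =>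
    ⟨huv.1, huv.2.imp (fun h => ⟨hX h.1, hY h.2⟩) (fun h => ⟨hY h.1, hX h.2⟩)⟩⟩

lemma exists_subset_disjoint_family {α : Type*} (Ds : List α) (φ : α → Finset V) (S : Finset V)
    {M : ℕ} (h : ∀ D ∈ Ds, (S ∩ φ D).card ≤ M) :
    ∃ S' ⊆ S, S.card ≤ S'.card + Ds.length * M ∧ ∀ D ∈ Ds, Disjoint S' (φ D) := by
  induction Ds with
  | nil => exact ⟨S, subset_rfl, by simp, by simp⟩
  | cons D Ds ih =>
    obtain ⟨S', h1, h2, h3⟩ := ih fun D' h' => h D' (List.mem_cons_of_mem _ h')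
    refine ⟨S' \ φ D, Finset.sdiff_subset.trans h1, ?_, ?_⟩
    · have e1 := Finset.card_sdiff_add_card_inter S' (φ D)
      have e2 := Finset.card_le_card (Finset.inter_subset_inter_right h1 (u := φ D))
      have e3 := h D (by simp)
      rw [List.length_cons, Nat.add_mul]
      omega
    · intro D' hD'
      rcases List.mem_cons.1 hD' with rfl | hD'
      · exact Finset.sdiff_disjoint
      · exact (h3 D' hD').mono_left Finset.sdiff_subset

lemma exists_isCyclePacking_of_noHole {h : ℕ} (hXY : Disjoint X Y) (hcard : X.card = Y.card)
    {ls : List (List V)} (hls : IsCyclePacking H X Y ls) {b : Bool}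
    (hno : NoHole (H b) (X \ ls.flatten.toFinset) (Y \ ls.flatten.toFinset) h) :
    ∃ l, IsCyclePacking H X Y (l :: ls) ∧
      (X \ (l :: ls).flatten.toFinset).card ≤ 4 * h := by
  obtain ⟨l, hl, hlc⟩ := exists_isCycleList_of_noHole
    (hXY.mono Finset.sdiff_subset Finset.sdiff_subset) (hls.card_sdiff_eq hXY hcard) hno
  have hl' : IsCyclePacking H _ _ [l] := ⟨by simpa using hl.1, fun l' hl' => by
    rw [List.mem_singleton] at hl'; exact ⟨b, hl' ▸ hl⟩⟩
  refine ⟨l, ⟨?_, ?_⟩, ?_⟩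
  · rw [List.flatten_cons, List.nodup_append]
    refine ⟨hl.1, hls.1, ?_⟩
    rintro v hv w hw rfl
    have := hl.subset_of_between v hv
    simp only [Finset.mem_union, Finset.mem_sdiff, List.mem_toFinset] at this
    tauto
  · intro l' h'
    rcases List.mem_cons.1 h' with rfl | h'
    · exact (hl'.mono Finset.sdiff_subset Finset.sdiff_subset).2 l' (by simp)
    · exact hls.2 l' h'
  · refine le_trans (Finset.card_le_card ?_) hlc
    intro v
    simp only [List.flatten_cons, List.toFinset_append, Finset.mem_sdiff, Finset.mem_union]
    tauto

lemma linked_of_complete {G : SimpleGraph V} {C : Finset V} {M : ℕ}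
    {D D' : Finset V × Finset V} (hC : M < C.card)
    (hD : M + 1 < (D.2.filter fun x => ∀ p ∈ C, G.Adj p x).card)
    (hD' : M + 1 < (D'.2.filter fun x => ∀ p ∈ C, G.Adj p x).card) : Linked G C M D D' := by
  intro F hF
  obtain ⟨p, hp, hpF⟩ := Finset.exists_mem_notMem_of_card_lt_card (hF.trans_lt hC)
  obtain ⟨q, hq, hqF⟩ := Finset.exists_mem_notMem_of_card_lt_card
    (hF.trans_lt ((Nat.lt_succ_self _).trans hD))
  obtain ⟨r, hr, hrF⟩ := Finset.exists_mem_notMem_of_card_lt_card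
    (((Finset.card_insert_le q F).trans (Nat.succ_le_succ hF)).trans_lt hD')
  rw [Finset.mem_insert, not_or] at hrF
  rw [Finset.mem_filter] at hq hr
  exact ⟨q, Finset.mem_sdiff.2 ⟨hq.1, hqF⟩, r, Finset.mem_sdiff.2 ⟨hr.1, hrF.2⟩,
    fun h => hrF.1 h.symm, p, Finset.mem_sdiff.2 ⟨hp, hpF⟩, hq.2 p hp, hr.2 p hp⟩

/-- The vertices of a balanced complete bipartite graph whose edges are coloured with two
colours can be covered, up to a small number of exceptions, by three disjoint monochromatic
cycles. -/
theorem exists_isCyclePacking_almost {q h : ℕ} (hXY : Disjoint X Y) (hcard : X.card = Y.card)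
    (hX : X.card ≤ q * h) (hq : 100 * (q + 1) ^ 2 ≤ h)
    (hH : ∀ x ∈ X, ∀ y ∈ Y, ∀ b, (H b).Adj x y ∨ (H !b).Adj x y) :
    ∃ ls, ls.length ≤ 3 ∧ IsCyclePacking H X Y ls ∧
      (X \ ls.flatten.toFinset).card ≤ 8 * h := by
  have hh : 0 < h := by nlinarith
  set M := 4 * q + 4 with hM
  have hqM : q * M + 2 * M + 2 ≤ h := by nlinarith
  have hMh : M < h := by nlinarith
  have hM2 : 3 * M + 4 ≤ h := by nlinarith
  have hlen : ∀ {G : SimpleGraph V} {P Q : Finset V} {Ds}, IsBicliqueFamily G P Q h Ds →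
      P.card ≤ X.card → Ds.length ≤ q := fun hD hP =>
    Nat.le_of_mul_le_mul_right (hD.length_mul_le.trans (hP.trans hX)) hh
  obtain ⟨Ds, hDs, hmax⟩ := exists_maximal_isBicliqueFamily (H false) X Y hh
  have hDl := hlen hDs le_rfl
  by_cases hlink : ∀ D₁ ∈ Ds, ∀ D₂ ∈ Ds, Linked (H false) X M D₁ D₂
  · obtain ⟨l, hl, -, hl2⟩ := exists_isCycleList_of_linked hXY subset_rfl hMh (by omega) hDs hlink
    have hls : IsCyclePacking H X Y [l] := ⟨by simpa using hl.1, fun l' hl' => by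
      rw [List.mem_singleton] at hl'; exact ⟨false, hl' ▸ hl⟩⟩
    obtain ⟨l', h1, h2⟩ := exists_isCyclePacking_of_noHole (h := 2 * h) (b := true) hXY hcard hls (by
      intro S hS T hT hSc hTc
      simp only [List.flatten_cons, List.flatten_nil, List.append_nil] at hS hT
      obtain ⟨S', hS', hSc', hSd⟩ := exists_subset_disjoint_family Ds Prod.fst S (M := M)
        fun D hD => (Finset.card_le_card fun v hv => by
          rw [Finset.mem_inter] at hv
          exact Finset.mem_sdiff.2 ⟨hv.2, (Finset.mem_sdiff.1 (hS hv.1)).2⟩).trans (hl2 D hD).1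
      obtain ⟨T', hT', hTc', hTd⟩ := exists_subset_disjoint_family Ds Prod.snd T (M := M)
        fun D hD => (Finset.card_le_card fun v hv => by
          rw [Finset.mem_inter] at hv
          exact Finset.mem_sdiff.2 ⟨hv.2, (Finset.mem_sdiff.1 (hT hv.1)).2⟩).trans (hl2 D hD).2
      have := Nat.mul_le_mul_right M hDl
      have hSX := hS.trans Finset.sdiff_subset
      have hTY := hT.trans Finset.sdiff_subset
      obtain ⟨s, hs, t, ht, hst⟩ := hmax S' (hS'.trans hSX) T' (hT'.trans hTY)
        (fun D hD => ⟨hSd D hD, hTd D hD⟩) (by omega) (by omega)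
      exact ⟨s, hS' hs, t, hT' ht, (hH s (hSX (hS' hs)) t (hTY (hT' ht)) true).resolve_right hst⟩)
    exact ⟨_, by simp, h1, by omega⟩
  · simp only [Linked] at hlink
    push Not at hlink
    obtain ⟨D, hD, D', hD', F, hF, hlink⟩ := hlink
    obtain ⟨-, d1, -, d2, -⟩ := hDs.1 D hD
    obtain ⟨-, d3, -, d4, -⟩ := hDs.1 D' hD'
    obtain ⟨H₁, hH₁, hc₁⟩ := Finset.exists_subset_card_eq (s := D.2 \ F) (n := M + 1) (by
      have := Finset.le_card_sdiff F D.2; omega)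
    obtain ⟨H₂, hH₂, hc₂⟩ := Finset.exists_subset_card_eq (s := (D'.2 \ F) \ H₁) (n := M + 1) (by
      have := Finset.le_card_sdiff F D'.2
      have := Finset.le_card_sdiff H₁ (D'.2 \ F)
      omega)
    have hH12 : Disjoint H₁ H₂ := (Finset.sdiff_disjoint.mono_left hH₂).symm
    have hH₁Y : H₁ ⊆ Y := (hH₁.trans Finset.sdiff_subset).trans d1
    have hH₂Y : H₂ ⊆ Y := ((hH₂.trans Finset.sdiff_subset).trans Finset.sdiff_subset).trans d3
    have hdich : ∀ x ∈ X \ F, (∀ p ∈ H₁, (H true).Adj p x) ∨ (∀ p ∈ H₂, (H true).Adj p x) := by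
      intro x hx
      by_contra! hc
      obtain ⟨⟨p, hp, hpx⟩, r, hr, hrx⟩ := hc
      have hxX := (Finset.mem_sdiff.1 hx).1
      have e1 := (hH x hxX p (hH₁Y hp) true).resolve_left fun h => hpx h.symm
      have e2 := (hH x hxX r (hH₂Y hr) true).resolve_left fun h => hrx h.symm
      exact hlink p (hH₁ hp) r (Finset.mem_sdiff.1 (hH₂ hr)).1
        (fun h => Finset.disjoint_left.1 hH12 hp (h ▸ hr)) x hx e1 e2
    obtain ⟨Es, hEs, hmax'⟩ := exists_maximal_isBicliqueFamily (H true) (Y \ (H₁ ∪ H₂)) (X \ F) hh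
    have hEl := hlen hEs ((Finset.card_le_card Finset.sdiff_subset).trans hcard.ge)
    have hEs' := hEs.mono (Finset.sdiff_subset (s := Y) (t := H₁ ∪ H₂))
      (Finset.sdiff_subset (s := X) (t := F))
    set p : Finset V × Finset V → Prop := fun E =>
      M + 1 < (E.2.filter fun x => ∀ p ∈ H₁, (H true).Adj p x).card with hp
    have hp2 : ∀ E ∈ Es, ¬ p E → M + 1 < (E.2.filter fun x => ∀ p ∈ H₂, (H true).Adj p x).card := by
      intro E hE hpE
      simp only [hp, not_lt] at hpE
      obtain ⟨-, e1, -, e2, -⟩ := hEs.1 E hE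
      have hsub : E.2 ⊆ (E.2.filter fun x => ∀ p ∈ H₁, (H true).Adj p x) ∪
          (E.2.filter fun x => ∀ p ∈ H₂, (H true).Adj p x) := by
        intro x hx
        rw [Finset.mem_union, Finset.mem_filter, Finset.mem_filter]
        exact (hdich x (e1 hx)).imp (fun h => ⟨hx, h⟩) (fun h => ⟨hx, h⟩)
      have := (Finset.card_le_card hsub).trans (Finset.card_union_le _ _)
      omega
    have hfl : ∀ r : Finset V × Finset V → Prop, (Es.filter (r ·)).length ≤ q :=
      fun r => (List.length_filter_le _ _).trans hEl
    have mf : ∀ (r : Finset V × Finset V → Prop) E, E ∈ Es.filter (r ·) ↔ E ∈ Es ∧ r E :=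
      fun r E => by rw [List.mem_filter, decide_eq_true_iff]
    obtain ⟨l₁, a1, a2, a3⟩ := exists_isCycleList_of_linked (C := H₁) (M := M) hXY.symm hH₁Y hMh
      (by have := hfl p; omega) (hEs'.filter p) (fun E hE E' hE' =>
        linked_of_complete (by omega) ((mf _ _).1 hE).2 ((mf _ _).1 hE').2)
    obtain ⟨l₂, b1, b2, b3⟩ := exists_isCycleList_of_linked (C := H₂) (M := M) hXY.symm hH₂Y hMh
      (by have := hfl fun E => ¬ p E; omega) (hEs'.filter fun E => ¬ p E) (fun E hE E' hE' =>
        linked_of_complete (by omega) (hp2 E ((mf _ _).1 hE).1 ((mf _ _).1 hE).2)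
          (hp2 E' ((mf _ _).1 hE').1 ((mf _ _).1 hE').2))
    rw [between_comm] at a1 b1
    have hdis : ∀ v ∈ l₁, v ∉ l₂ := by
      intro v h1 h2
      have hXY' : ∀ v, v ∈ X → v ∉ Y := fun v hx hy => Finset.disjoint_left.1 hXY hx hy
      have hE : ∀ E ∈ Es, E.1 ⊆ Y \ (H₁ ∪ H₂) ∧ E.2 ⊆ X \ F := fun E hE =>
        ⟨(hEs.1 E hE).1, (hEs.1 E hE).2.1⟩
      have hY' : ∀ v ∈ Y \ (H₁ ∪ H₂), v ∈ Y ∧ v ∉ H₁ ∧ v ∉ H₂ := fun v hv => by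
        simpa [not_or] using hv
      have hX' : ∀ v ∈ X \ F, v ∈ X := fun v hv => (Finset.mem_sdiff.1 hv).1
      rcases a2 v h1 with h1 | ⟨E, hE1, h1⟩
      · rcases b2 v h2 with h2 | ⟨E', hE2, h2⟩
        · exact Finset.disjoint_left.1 hH12 h1 h2
        · have := hE E' ((mf _ _).1 hE2).1
          rcases h2 with h2 | h2
          · exact (hY' v (this.1 h2)).2.1 h1
          · exact hXY' v (hX' v (this.2 h2)) (hH₁Y h1)
      · obtain ⟨m1, m2⟩ := (mf _ _).1 hE1
        have e1 := hE E m1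
        rcases b2 v h2 with h2 | ⟨E', hE2, h2⟩
        · rcases h1 with h1 | h1
          · exact (hY' v (e1.1 h1)).2.2 h2
          · exact hXY' v (hX' v (e1.2 h1)) (hH₂Y h2)
        · obtain ⟨m3, m4⟩ := (mf (fun E => ¬ p E) _).1 hE2
          have e2 := hE E' m3
          have : Std.Symm fun E E' : Finset V × Finset V => Disjoint E.1 E'.1 ∧ Disjoint E.2 E'.2 :=
            ⟨fun _ _ h => ⟨h.1.symm, h.2.symm⟩⟩
          have hpair := hEs.2.forall m1 m3 (fun h => m4 (h ▸ m2))
          rcases h1 with h1 | h1 <;> rcases h2 with h2 | h2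
          · exact Finset.disjoint_left.1 hpair.1 h1 h2
          · exact hXY' v (hX' v (e2.2 h2)) (hY' v (e1.1 h1)).1
          · exact hXY' v (hX' v (e1.2 h1)) (hY' v (e2.1 h2)).1
          · exact Finset.disjoint_left.1 hpair.2 h1 h2
    have hls : IsCyclePacking H X Y [l₁, l₂] := by
      refine ⟨?_, ?_⟩
      · simp only [List.flatten_cons, List.flatten_nil, List.append_nil, List.nodup_append]
        exact ⟨a1.1, b1.1, fun v hv w hw h => hdis v hv (h ▸ hw)⟩
      · intro l hl
        simp only [List.mem_cons, List.not_mem_nil, or_false] at hl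
        rcases hl with rfl | rfl
        · exact ⟨true, a1⟩
        · exact ⟨true, b1⟩
    have hmiss : ∀ E ∈ Es, (E.1 \ [l₁, l₂].flatten.toFinset).card ≤ M ∧
        (E.2 \ [l₁, l₂].flatten.toFinset).card ≤ M := by
      intro E hE
      have s1 : l₁.toFinset ⊆ [l₁, l₂].flatten.toFinset := by intro v; simp; tauto
      have s2 : l₂.toFinset ⊆ [l₁, l₂].flatten.toFinset := by intro v; simp; tauto
      by_cases hpE : p E
      · have := a3 E ((mf _ _).2 ⟨hE, hpE⟩)
        exact ⟨(Finset.card_le_card (Finset.sdiff_subset_sdiff subset_rfl s1)).trans this.1,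
          (Finset.card_le_card (Finset.sdiff_subset_sdiff subset_rfl s1)).trans this.2⟩
      · have := b3 E ((mf (fun E => ¬ p E) _).2 ⟨hE, hpE⟩)
        exact ⟨(Finset.card_le_card (Finset.sdiff_subset_sdiff subset_rfl s2)).trans this.1,
          (Finset.card_le_card (Finset.sdiff_subset_sdiff subset_rfl s2)).trans this.2⟩
    obtain ⟨l', h1, h2⟩ := exists_isCyclePacking_of_noHole (h := 2 * h) (b := false) hXY hcard hls (by
      intro S hS T hT hSc hTc
      set U := [l₁, l₂].flatten.toFinset with hU
      have hSF : S.card ≤ (S \ F).card + M := by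
        have := Finset.le_card_sdiff F S; omega
      have hTH : T.card ≤ (T \ (H₁ ∪ H₂)).card + (2 * M + 2) := by
        have := Finset.le_card_sdiff (H₁ ∪ H₂) T
        have := Finset.card_union_le H₁ H₂
        omega
      obtain ⟨S', hS', hSc', hSd⟩ := exists_subset_disjoint_family Es Prod.snd (S \ F) (M := M)
        fun D hD => (Finset.card_le_card fun v hv => by
          rw [Finset.mem_inter] at hv
          exact Finset.mem_sdiff.2 ⟨hv.2, (Finset.mem_sdiff.1
            (hS (Finset.mem_sdiff.1 hv.1).1)).2⟩).trans (hmiss D hD).2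
      obtain ⟨T', hT', hTc', hTd⟩ := exists_subset_disjoint_family Es Prod.fst (T \ (H₁ ∪ H₂))
        (M := M) fun D hD => (Finset.card_le_card fun v hv => by
          rw [Finset.mem_inter] at hv
          exact Finset.mem_sdiff.2 ⟨hv.2, (Finset.mem_sdiff.1
            (hT (Finset.mem_sdiff.1 hv.1).1)).2⟩).trans (hmiss D hD).1
      have := Nat.mul_le_mul_right M hEl
      have hSX := hS.trans Finset.sdiff_subset
      have hTY := hT.trans Finset.sdiff_subset
      obtain ⟨t, ht, s, hs, hst⟩ := hmax' T' (hT'.trans (Finset.sdiff_subset_sdiff hTY subset_rfl))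
        S' (hS'.trans (Finset.sdiff_subset_sdiff hSX subset_rfl))
        (fun D hD => ⟨hTd D hD, hSd D hD⟩) (by omega) (by omega)
      have hsS := (Finset.mem_sdiff.1 (hS' hs)).1
      have htT := (Finset.mem_sdiff.1 (hT' ht)).1
      exact ⟨s, hsS, t, htT, (hH s (hSX hsS) t (hTY htT) false).resolve_right
        fun h => hst h.symm⟩)
    exact ⟨_, by simp, h1, by omega⟩

end AlmostCover

section Absorber

variable {V : Type*} {H : Bool → SimpleGraph V} {A B : Finset V}

/-- Between `A` and `B` the graph `G` is balanced, has large minimum degree and no large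
holes; both properties survive the removal or addition of a few suitable vertices. -/
def IsAbsorber (G : SimpleGraph V) (A B : Finset V) (s : ℕ) : Prop :=
  Disjoint A B ∧ A.card = B.card ∧ 13 * s ≤ A.card ∧
  (∀ a ∈ A, 6 * s ≤ (B.filter (G.Adj a)).card) ∧ (∀ b ∈ B, 6 * s ≤ (A.filter (G.Adj b)).card) ∧
  NoHole G A B s

lemma NoHole.symm {G : SimpleGraph V} {s : ℕ} (h : NoHole G A B s) : NoHole G B A s := by
  intro S hS T hT h1 h2
  obtain ⟨t, ht, r, hr, htr⟩ := h T hT S hS h2 h1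
  exact ⟨r, hr, t, ht, htr.symm⟩

lemma IsAbsorber.symm {G : SimpleGraph V} {s : ℕ} (h : IsAbsorber G A B s) :
    IsAbsorber G B A s := by
  obtain ⟨h1, h2, h3, h4, h5, h6⟩ := h
  exact ⟨h1.symm, h2.symm, h2 ▸ h3, h5, h4, h6.symm⟩

/-- If any two vertices of `W` have many common neighbours in `B`, then `W` can be covered by a
cycle alternating between `W` and `B`. -/
lemma exists_isCycleList_of_common {G : SimpleGraph V} {W B : Finset V} (hWB : Disjoint W B)
    (hG : ∀ w ∈ W, ∀ w' ∈ W, W.card ≤ (B.filter fun b => G.Adj w b ∧ G.Adj w' b).card) :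
    ∃ l, IsCycleList (G.between W B) l ∧ W ⊆ l.toFinset := by
  have hd : ∀ v, v ∈ W → v ∉ B := fun v hx hy => Finset.disjoint_left.1 hWB hx hy
  have hpick : ∀ w ∈ W, ∀ w' ∈ W, ∀ l : List V, (l.toFinset ∩ B).card < W.card →
      ∃ b ∈ B, b ∉ l ∧ G.Adj w b ∧ G.Adj w' b := by
    intro w hw w' hw' l hl
    obtain ⟨b, hb, hbl⟩ := Finset.exists_mem_notMem_of_card_lt_card (hl.trans_le (hG w hw w' hw'))
    rw [Finset.mem_filter] at hb
    exact ⟨b, hb.1, fun h => hbl (by simp [h, hb.1]), hb.2⟩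
  rcases W.eq_empty_or_nonempty with rfl | hne
  · exact ⟨[], IsCycleList.nil, by simp⟩
  have key : ∀ W' ⊆ W, W'.Nonempty → ∃ (l : List V) (w w' : V), l.Nodup ∧
      l.IsChain (G.between W B).Adj ∧ l.head? = some w ∧ l.getLast? = some w' ∧ w ∈ W ∧ w' ∈ W ∧
      W' ⊆ l.toFinset ∧ (∀ v ∈ l, v ∈ W → v ∈ W') ∧ (l.toFinset ∩ B).card + 1 = W'.card := by
    intro W' hW' hne'
    induction hne' using Finset.Nonempty.cons_induction with
    | singleton a =>
      have ha : a ∈ W := by simpa using hW'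
      refine ⟨[a], a, a, by simp, by simp, by simp, by simp, ha, ha, by simp, by simp, ?_⟩
      have : ([a] : List V).toFinset ∩ B = ∅ := by
        ext v; simp; rintro rfl; exact hd v ha
      rw [this]; simp
    | cons x W' hx hne' ih =>
      rw [Finset.cons_eq_insert] at hW' ⊢
      obtain ⟨l, w, w', h1, h2, h3, h4, h5, h6, h7, h8, h9⟩ :=
        ih ((Finset.subset_insert _ _).trans hW')
      have hcW := Finset.card_le_card ((Finset.subset_insert _ _).trans hW')
      have hxW : x ∈ W := hW' (Finset.mem_insert_self _ _)
      obtain ⟨b, hb, hbl, hxb, hwb⟩ := hpick x hxW w h5 l (by omega)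
      have hxl : x ∉ l := fun h => hx (h8 x h hxW)
      refine ⟨x :: b :: l, x, w', ?_, ?_, by simp, ?_, hxW, h6, ?_, ?_, ?_⟩
      · rw [List.nodup_cons, List.nodup_cons, List.mem_cons, not_or]
        exact ⟨⟨hxb.ne, hxl⟩, hbl, h1⟩
      · rw [List.isChain_cons_cons, List.isChain_cons, h3]
        refine ⟨⟨hxb, Or.inl ⟨hxW, hb⟩⟩, ?_, h2⟩
        simp only [Option.mem_def, Option.some.injEq]
        rintro _ rfl
        exact ⟨hwb.symm, Or.inr ⟨hb, h5⟩⟩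
      · rw [List.getLast?_cons, List.getLast?_cons, h4]; simp
      · intro v hv
        rcases Finset.mem_insert.1 hv with rfl | hv
        · simp
        · have := h7 hv
          rw [List.mem_toFinset] at this ⊢
          simp [this]
      · intro v hv hvW
        rw [List.mem_cons, List.mem_cons] at hv
        rcases hv with rfl | rfl | hv
        · simp
        · exact absurd hb (hd v hvW)
        · exact Finset.mem_insert_of_mem (h8 v hv hvW)
      · have : (x :: b :: l).toFinset ∩ B = insert b (l.toFinset ∩ B) := by
          rw [List.toFinset_cons, List.toFinset_cons, Finset.insert_inter_of_notMem (hd x hxW),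
            Finset.insert_inter_of_mem hb]
        rw [this, Finset.card_insert_of_notMem (by simp [hbl]), Finset.card_insert_of_notMem hx, h9]
  obtain ⟨l, w, w', h1, h2, h3, h4, h5, h6, h7, h8, h9⟩ := key W subset_rfl hne
  obtain ⟨b, hb, hbl, hwb, hwb'⟩ := hpick w h5 w' h6 l (by omega)
  refine ⟨b :: l, ⟨List.nodup_cons.2 ⟨hbl, h1⟩, ?_, ?_⟩, ?_⟩
  · rw [List.isChain_cons, h3]
    refine ⟨?_, h2⟩
    simp only [Option.mem_def, Option.some.injEq]
    rintro _ rfl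
    exact ⟨hwb.symm, Or.inr ⟨hb, h5⟩⟩
  · rw [List.getLast?_cons, h4]
    simp only [List.head?_cons, Option.mem_def, Option.some.injEq, Option.getD_some]
    rintro _ rfl _ rfl
    exact ⟨hwb', Or.inl ⟨h6, hb⟩⟩
  · intro v hv
    have := h7 hv
    rw [List.mem_toFinset] at this ⊢
    exact List.mem_cons_of_mem _ this

lemma card_le_card_filter_common {W B : Finset V} {c : Bool} {s : ℕ} (hs : 13 * s ≤ B.card)
    (hH : ∀ w ∈ W, ∀ b ∈ B, (H c).Adj w b ∨ (H !c).Adj w b)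
    (hW : ∀ w ∈ W, (B.filter ((H c).Adj w)).card < 6 * s) {w w' : V} (hw : w ∈ W)
    (hw' : w' ∈ W) : s ≤ (B.filter fun b => (H !c).Adj w b ∧ (H !c).Adj w' b).card := by
  have h1 := hW w hw
  have h2 := hW w' hw'
  have hsub : B ⊆ (B.filter fun b => (H !c).Adj w b ∧ (H !c).Adj w' b) ∪
      (B.filter ((H c).Adj w) ∪ B.filter ((H c).Adj w')) := by
    intro b hb
    have e1 := hH w hw b hb
    have e2 := hH w' hw' b hb
    simp only [Finset.mem_union, Finset.mem_filter]
    tauto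
  have h3 := (Finset.card_le_card hsub).trans (Finset.card_union_le _ _)
  have h4 := Finset.card_union_le (B.filter ((H c).Adj w)) (B.filter ((H c).Adj w'))
  omega

/-- An absorber together with two small sets of equal size can be covered by three disjoint
monochromatic cycles. -/
theorem IsAbsorber.exists_cover {c : Bool} {s : ℕ} (hA : IsAbsorber (H c) A B s)
    {W₁ W₂ : Finset V} (h₁₂ : Disjoint W₁ W₂) (h₁A : Disjoint W₁ A) (h₁B : Disjoint W₁ B)
    (h₂A : Disjoint W₂ A) (h₂B : Disjoint W₂ B) (hcard : W₁.card = W₂.card) (hs : W₁.card ≤ s)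
    (hH₁ : ∀ w ∈ W₁, ∀ b ∈ B, (H c).Adj w b ∨ (H !c).Adj w b)
    (hH₂ : ∀ w ∈ W₂, ∀ a ∈ A, (H c).Adj w a ∨ (H !c).Adj w a) :
    ∃ ls : List (List V), ls.length = 3 ∧ ls.flatten.Nodup ∧
      (∀ l ∈ ls, ∃ b, IsCycleList (H b) l) ∧
      ls.flatten.toFinset = (A ∪ W₁) ∪ (B ∪ W₂) := by
  obtain ⟨hAB, hABc, hk, hdA, hdB, hno⟩ := hA
  have hW : ∀ (W C : Finset V), W.card ≤ s → Disjoint W C → 13 * s ≤ C.card →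
      (∀ w ∈ W, ∀ b ∈ C, (H c).Adj w b ∨ (H !c).Adj w b) →
      ∃ l U D, IsCycleList (H !c) l ∧ U ⊆ C ∧ D ⊆ W ∧ U.card = D.card ∧ l.toFinset = D ∪ U ∧
        ∀ w ∈ W, w ∉ D → 6 * s ≤ (C.filter ((H c).Adj w)).card := by
    intro W C hWs hWC hC hHW
    set D := W.filter fun w => (C.filter ((H c).Adj w)).card < 6 * s with hD
    have hDW : D ⊆ W := Finset.filter_subset _ _
    have hDC : Disjoint D C := hWC.mono_left hDW
    obtain ⟨l, hl, hDl⟩ := exists_isCycleList_of_common (G := H !c) hDC fun w hw w' hw' =>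
      ((Finset.card_le_card hDW).trans hWs).trans (card_le_card_filter_common hC
        (fun w hw => hHW w (hDW hw)) (fun w hw => (Finset.mem_filter.1 hw).2) hw hw')
    refine ⟨l, l.toFinset ∩ C, D, hl.mono between_le, Finset.inter_subset_right, hDW, ?_, ?_, ?_⟩
    · rw [← hl.card_inter_eq hDC, Finset.inter_eq_right.2 hDl]
    · ext v
      have h1 := hl.subset_of_between v
      have h2 := @hDl v
      simp only [List.mem_toFinset, Finset.mem_union, Finset.mem_inter] at *
      tauto
    · intro w hw hwD
      by_contra hc
      exact hwD (Finset.mem_filter.2 ⟨hw, not_le.1 hc⟩)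
  obtain ⟨l₁, U₁, D₁, p1, p2, p3, p4, p5, p6⟩ := hW W₁ B hs h₁B (hABc ▸ hk) hH₁
  obtain ⟨l₂, U₂, D₂, q1, q2, q3, q4, q5, q6⟩ := hW W₂ A (hcard ▸ hs) h₂A hk hH₂
  set X := (A \ U₂) ∪ (W₁ \ D₁) with hX
  set Y := (B \ U₁) ∪ (W₂ \ D₂) with hY
  have hD₁ := Finset.card_le_card p3
  have hD₂ := Finset.card_le_card q3
  have hdis : ∀ v, (v ∈ W₁ → v ∉ W₂) ∧ (v ∈ W₁ → v ∉ A) ∧ (v ∈ W₁ → v ∉ B) ∧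
      (v ∈ W₂ → v ∉ A) ∧ (v ∈ W₂ → v ∉ B) ∧ (v ∈ A → v ∉ B) := fun v =>
    ⟨fun h => Finset.disjoint_left.1 h₁₂ h, fun h => Finset.disjoint_left.1 h₁A h,
      fun h => Finset.disjoint_left.1 h₁B h, fun h => Finset.disjoint_left.1 h₂A h,
      fun h => Finset.disjoint_left.1 h₂B h, fun h => Finset.disjoint_left.1 hAB h⟩
  have hXY : Disjoint X Y := by
    rw [Finset.disjoint_left]
    intro v
    have := hdis v
    simp only [hX, hY, Finset.mem_union, Finset.mem_sdiff]
    tauto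
  have hXc : X.card = (A.card - D₂.card) + (W₁.card - D₁.card) := by
    rw [hX, Finset.card_union_of_disjoint
      ((h₁A.symm.mono_left Finset.sdiff_subset).mono_right Finset.sdiff_subset),
      Finset.card_sdiff_of_subset q2, Finset.card_sdiff_of_subset p3, q4]
  have hYc : Y.card = (B.card - D₁.card) + (W₂.card - D₂.card) := by
    rw [hY, Finset.card_union_of_disjoint
      ((h₂B.symm.mono_left Finset.sdiff_subset).mono_right Finset.sdiff_subset),
      Finset.card_sdiff_of_subset p2, Finset.card_sdiff_of_subset q3, p4]
  have hdeg : ∀ (C U Z : Finset V) (v : V), U.card ≤ s → C \ U ⊆ Z →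
      6 * s ≤ (C.filter ((H c).Adj v)).card →
      2 * (2 * s) ≤ (Z.filter ((H c).Adj v)).card := by
    intro C U Z v hU hZ h
    have h1 : C.filter ((H c).Adj v) \ U ⊆ Z.filter ((H c).Adj v) := by
      intro w hw
      rw [Finset.mem_sdiff, Finset.mem_filter] at hw
      exact Finset.mem_filter.2 ⟨hZ (Finset.mem_sdiff.2 ⟨hw.1.1, hw.2⟩), hw.1.2⟩
    have h2 := Finset.card_le_card h1
    have h3 := Finset.le_card_sdiff U (C.filter ((H c).Adj v))
    omega
  obtain ⟨l, hl, hlt⟩ := exists_hamilton_isCycleList (G := H c) (h := 2 * s) hXY (by omega)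
    (fun x hx => hdeg B U₁ Y x (by omega) Finset.subset_union_left (by
      rcases Finset.mem_union.1 hx with h | h
      · exact hdA x (Finset.mem_sdiff.1 h).1
      · exact p6 x (Finset.mem_sdiff.1 h).1 (Finset.mem_sdiff.1 h).2))
    (fun x hx => hdeg A U₂ X x (by omega) Finset.subset_union_left (by
      rcases Finset.mem_union.1 hx with h | h
      · exact hdB x (Finset.mem_sdiff.1 h).1
      · exact q6 x (Finset.mem_sdiff.1 h).1 (Finset.mem_sdiff.1 h).2))
    (by
      intro S hS T hT hSc hTc
      have hin : ∀ (S C U W D : Finset V), S ⊆ (C \ U) ∪ (W \ D) → W.card ≤ s → 2 * s ≤ S.card →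
          s ≤ (S ∩ C).card := by
        intro S C U W D hS hW hSc
        have : S ⊆ (S ∩ C) ∪ W := by
          intro v hv
          have := hS hv
          simp only [Finset.mem_union, Finset.mem_sdiff, Finset.mem_inter] at *
          tauto
        have := (Finset.card_le_card this).trans (Finset.card_union_le _ _)
        omega
      obtain ⟨a, ha, b, hb, hab⟩ := hno (S ∩ A) Finset.inter_subset_right (T ∩ B)
        Finset.inter_subset_right (hin _ _ _ _ _ hS hs hSc) (hin _ _ _ _ _ hT (hcard ▸ hs) hTc)
      exact ⟨a, (Finset.mem_inter.1 ha).1, b, (Finset.mem_inter.1 hb).1, hab⟩)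
  have m1 : ∀ v, v ∈ l₁ ↔ v ∈ D₁ ∨ v ∈ U₁ := fun v => by
    rw [← List.mem_toFinset, p5, Finset.mem_union]
  have m2 : ∀ v, v ∈ l₂ ↔ v ∈ D₂ ∨ v ∈ U₂ := fun v => by
    rw [← List.mem_toFinset, q5, Finset.mem_union]
  have m3 : ∀ v, v ∈ l ↔ (v ∈ A ∧ v ∉ U₂ ∨ v ∈ W₁ ∧ v ∉ D₁) ∨ (v ∈ B ∧ v ∉ U₁ ∨ v ∈ W₂ ∧ v ∉ D₂) :=
    fun v => by
      rw [← List.mem_toFinset, hlt]; simp only [hX, hY, Finset.mem_union, Finset.mem_sdiff]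
  refine ⟨[l, l₁, l₂], rfl, ?_, ?_, ?_⟩
  · simp only [List.flatten_cons, List.flatten_nil, List.append_nil, List.nodup_append]
    refine ⟨hl.1, ⟨p1.1, q1.1, ?_⟩, ?_⟩
    · rintro v hv w hw rfl
      obtain ⟨d1, d2, d3, d4, d5, d6⟩ := hdis v
      rcases (m1 v).1 hv with h1 | h1 <;> rcases (m2 v).1 hw with h2 | h2
      · exact d1 (p3 h1) (q3 h2)
      · exact d2 (p3 h1) (q2 h2)
      · exact d5 (q3 h2) (p2 h1)
      · exact d6 (q2 h2) (p2 h1)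
    · rintro v hv w hw rfl
      obtain ⟨d1, d2, d3, d4, d5, d6⟩ := hdis v
      rw [List.mem_append, m1, m2] at hw
      rcases (m3 v).1 hv with (h | h) | (h | h) <;> rcases hw with (hw | hw) | (hw | hw)
      · exact d2 (p3 hw) h.1
      · exact d6 h.1 (p2 hw)
      · exact d4 (q3 hw) h.1
      · exact h.2 hw
      · exact h.2 hw
      · exact d3 h.1 (p2 hw)
      · exact d1 h.1 (q3 hw)
      · exact d2 h.1 (q2 hw)
      · exact d3 (p3 hw) h.1
      · exact h.2 hw
      · exact d5 (q3 hw) h.1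
      · exact d6 (q2 hw) h.1
      · exact d1 (p3 hw) h.1
      · exact d5 h.1 (p2 hw)
      · exact h.2 hw
      · exact d4 h.1 (q2 hw)
  · intro l' hl'
    simp only [List.mem_cons, List.not_mem_nil, or_false] at hl'
    rcases hl' with rfl | rfl | rfl
    · exact ⟨c, hl.mono between_le⟩
    · exact ⟨!c, p1⟩
    · exact ⟨!c, q1⟩
  · ext v
    simp only [List.flatten_cons, List.flatten_nil, List.append_nil, List.toFinset_append,
      Finset.mem_union, List.mem_toFinset, m1, m2, m3]
    constructor
    · rintro (((h | h) | (h | h)) | (h | h) | (h | h))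
      exacts [Or.inl (Or.inl h.1), Or.inl (Or.inr h.1), Or.inr (Or.inl h.1), Or.inr (Or.inr h.1),
        Or.inl (Or.inr (p3 h)), Or.inr (Or.inl (p2 h)), Or.inr (Or.inr (q3 h)),
        Or.inl (Or.inl (q2 h))]
    · rintro ((h | h) | (h | h))
      · by_cases hv : v ∈ U₂
        exacts [Or.inr (Or.inr (Or.inr hv)), Or.inl (Or.inl (Or.inl ⟨h, hv⟩))]
      · by_cases hv : v ∈ D₁
        exacts [Or.inr (Or.inl (Or.inl hv)), Or.inl (Or.inl (Or.inr ⟨h, hv⟩))]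
      · by_cases hv : v ∈ U₁
        exacts [Or.inr (Or.inl (Or.inr hv)), Or.inl (Or.inr (Or.inl ⟨h, hv⟩))]
      · by_cases hv : v ∈ D₂
        exacts [Or.inr (Or.inr (Or.inl hv)), Or.inl (Or.inr (Or.inr ⟨h, hv⟩))]

end Absorber

section AbsorberExistence

variable {V : Type*} {G G' : SimpleGraph V} {A B : Finset V}

/-- If few vertices of `B` are `G`-adjacent to each vertex of `A`, then few vertices of `B` have
large `G`-degree into `A`. -/
lemma card_filter_lt_mul_le (G : SimpleGraph V) (A B : Finset V) {d e : ℕ}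
    (hd : ∀ a ∈ A, (B.filter (G.Adj a)).card ≤ d) :
    (B.filter fun b => e ≤ (A.filter (G.Adj b)).card).card * e ≤ A.card * d := by
  refine Finset.card_mul_le_card_mul G.Adj (fun b hb => (Finset.mem_filter.1 hb).2)
    fun a ha => le_trans (Finset.card_le_card ?_) (hd a ha)
  intro b hb
  simp only [Finset.bipartiteBelow, Finset.mem_filter] at hb ⊢
  exact ⟨hb.1.1, hb.2.symm⟩

lemma isAbsorber_of_sparse {u : ℕ} (hu : 0 < u) (hAB : Disjoint A B) (hA : A.card = 1000 * u)
    (hB : B.card = 1000 * u) (hG : ∀ a ∈ A, ∀ b ∈ B, G.Adj a b ∨ G'.Adj a b)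
    (hdA : ∀ a ∈ A, (B.filter (G.Adj a)).card ≤ 50 * u)
    (hdB : ∀ b ∈ B, (A.filter (G.Adj b)).card ≤ 50 * u) : IsAbsorber G' A B (51 * u) := by
  have hdeg : ∀ (C : Finset V) (v : V), C.card = 1000 * u →
      (∀ w ∈ C, G.Adj v w ∨ G'.Adj v w) → (C.filter (G.Adj v)).card ≤ 50 * u →
      6 * (51 * u) ≤ (C.filter (G'.Adj v)).card := by
    intro C v hC hv hd
    have hsub : C ⊆ C.filter (G.Adj v) ∪ C.filter (G'.Adj v) := by
      intro w hw
      rw [Finset.mem_union, Finset.mem_filter, Finset.mem_filter]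
      exact (hv w hw).imp (⟨hw, ·⟩) (⟨hw, ·⟩)
    have := (Finset.card_le_card hsub).trans (Finset.card_union_le _ _)
    omega
  refine ⟨hAB, hA.trans hB.symm, by omega, fun a ha => hdeg B a hB (hG a ha) (hdA a ha),
    fun b hb => hdeg A b hA (fun a ha => ?_) (hdB b hb), ?_⟩
  · rw [G.adj_comm, G'.adj_comm]; exact hG a ha b hb
  · intro S hS T hT hSc hTc
    by_contra! hno
    obtain ⟨s, hs⟩ : S.Nonempty := Finset.card_pos.1 (by omega)
    have hsub : T ⊆ B.filter (G.Adj s) := fun t ht => Finset.mem_filter.2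
      ⟨hT ht, (hG s (hS hs) t (hT ht)).resolve_right (hno s hs t ht)⟩
    have := Finset.card_le_card hsub
    have := hdA s (hS hs)
    omega

lemma exists_isAbsorber_of_low_degree {u : ℕ} (hu : 0 < u) (hAB : Disjoint A B)
    (hA : 2000 * u ≤ A.card) (hB : B.card = 25000 * (1000 * u))
    (hG : ∀ a ∈ A, ∀ b ∈ B, G.Adj a b ∨ G'.Adj a b)
    (hd : ∀ a ∈ A, (B.filter (G.Adj a)).card ≤ 10 * (1000 * u)) :
    ∃ A' ⊆ A, ∃ B' ⊆ B, IsAbsorber G' A' B' (51 * u) ∧ A'.card = 1000 * u := by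
  obtain ⟨S, hSA, hS⟩ := Finset.exists_subset_card_eq hA
  have h1 := card_filter_lt_mul_le G S B (e := u) fun a ha => hd a (hSA ha)
  have h1' : (B.filter fun b => u ≤ (S.filter (G.Adj b)).card).card ≤ 20000 * (1000 * u) := by
    rw [hS] at h1
    refine Nat.le_of_mul_le_mul_right (h1.trans (le_of_eq ?_)) hu
    ring
  obtain ⟨T, hTB, hT⟩ : ∃ T ⊆ B \ (B.filter fun b => u ≤ (S.filter (G.Adj b)).card),
      T.card = 1000 * u := by
    apply Finset.exists_subset_card_eq
    have := Finset.le_card_sdiff (B.filter fun b => u ≤ (S.filter (G.Adj b)).card) B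
    omega
  have hTd : ∀ b ∈ T, (S.filter (G.Adj b)).card ≤ u := by
    intro b hb
    obtain ⟨hbB, hb⟩ := Finset.mem_sdiff.1 (hTB hb)
    by_contra hc
    exact hb (Finset.mem_filter.2 ⟨hbB, by omega⟩)
  have h2 := card_filter_lt_mul_le G T S (e := 50 * u) hTd
  have h2' : (S.filter fun a => 50 * u ≤ (T.filter (G.Adj a)).card).card ≤ 20 * u := by
    rw [hT] at h2
    refine Nat.le_of_mul_le_mul_right (h2.trans (le_of_eq ?_)) (by omega : 0 < 50 * u)
    ring
  obtain ⟨S', hSS, hS'⟩ :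
      ∃ S' ⊆ S \ (S.filter fun a => 50 * u ≤ (T.filter (G.Adj a)).card), S'.card = 1000 * u := by
    apply Finset.exists_subset_card_eq
    have := Finset.le_card_sdiff (S.filter fun a => 50 * u ≤ (T.filter (G.Adj a)).card) S
    omega
  have hS'S : S' ⊆ S := hSS.trans Finset.sdiff_subset
  have hTB' : T ⊆ B := hTB.trans Finset.sdiff_subset
  refine ⟨S', hS'S.trans hSA, T, hTB', isAbsorber_of_sparse hu
    ((hAB.mono_left (hS'S.trans hSA)).mono_right hTB') hS' hT
    (fun a ha b hb => hG a (hSA (hS'S ha)) b (hTB' hb)) ?_ ?_, hS'⟩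
  · intro a ha
    obtain ⟨haS, ha⟩ := Finset.mem_sdiff.1 (hSS ha)
    by_contra hc
    exact ha (Finset.mem_filter.2 ⟨haS, by omega⟩)
  · intro b hb
    have h3 := hTd b hb
    have h4 := Finset.card_le_card (Finset.filter_subset_filter (G.Adj b) hS'S)
    omega

/-- Between any two large sets, all edges of which are coloured, there is an absorber. -/
theorem exists_isAbsorber {H : Bool → SimpleGraph V} {u : ℕ} (hu : 0 < u) (hAB : Disjoint A B)
    (hA : 25000 * (1000 * u) ≤ A.card) (hB : 25000 * (1000 * u) ≤ B.card)
    (hH : ∀ a ∈ A, ∀ b ∈ B, (H true).Adj a b ∨ (H false).Adj a b) :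
    ∃ c, ∃ A' ⊆ A, ∃ B' ⊆ B, ∃ s, IsAbsorber (H c) A' B' s ∧ 51 * u ≤ s ∧
      A'.card ≤ 25000 * (1000 * u) := by
  obtain ⟨A₀, hA₀, hA₀c⟩ := Finset.exists_subset_card_eq hA
  obtain ⟨B₀, hB₀, hB₀c⟩ := Finset.exists_subset_card_eq hB
  have hAB₀ : Disjoint A₀ B₀ := (hAB.mono_left hA₀).mono_right hB₀
  have hH₀ : ∀ a ∈ A₀, ∀ b ∈ B₀, (H true).Adj a b ∨ (H false).Adj a b :=
    fun a ha b hb => hH a (hA₀ ha) b (hB₀ hb)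
  have hH₀' : ∀ b ∈ B₀, ∀ a ∈ A₀, (H true).Adj b a ∨ (H false).Adj b a :=
    fun b hb a ha => (hH₀ a ha b hb).imp Adj.symm Adj.symm
  set L := A₀.filter fun a => (B₀.filter ((H true).Adj a)).card ≤ 10 * (1000 * u) with hL
  set R := B₀.filter fun b => (A₀.filter ((H true).Adj b)).card ≤ 10 * (1000 * u) with hR
  have hLA : L ⊆ A₀ := Finset.filter_subset _ _
  have hRB : R ⊆ B₀ := Finset.filter_subset _ _
  rcases le_or_gt (2000 * u) L.card with hLc | hLc
  · obtain ⟨A', hA', B', hB', h, hc⟩ := exists_isAbsorber_of_low_degree hu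
      (hAB₀.mono_left hLA) hLc hB₀c (fun a ha => hH₀ a (hLA ha))
      fun a ha => (Finset.mem_filter.1 ha).2
    exact ⟨false, A', (hA'.trans hLA).trans hA₀, B', hB'.trans hB₀, _, h, le_rfl, by omega⟩
  rcases le_or_gt (2000 * u) R.card with hRc | hRc
  · obtain ⟨B', hB', A', hA', h, hc⟩ := exists_isAbsorber_of_low_degree hu
      (hAB₀.symm.mono_left hRB) hRc hA₀c (fun b hb => hH₀' b (hRB hb))
      fun a ha => (Finset.mem_filter.1 ha).2
    exact ⟨false, A', hA'.trans hA₀, B', (hB'.trans hRB).trans hB₀, _, h.symm, le_rfl,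
      by rw [← h.2.1]; omega⟩
  by_cases hno : NoHole (H true) A₀ B₀ (1000 * u)
  · obtain ⟨S, hLS, hSA, hS⟩ := Finset.exists_subsuperset_card_eq hLA hLc.le (by omega)
    obtain ⟨T, hRT, hTB, hT⟩ := Finset.exists_subsuperset_card_eq hRB hRc.le (by omega)
    have hdeg : ∀ (C T : Finset V) (v : V), T.card = 2000 * u →
        10 * (1000 * u) < (C.filter ((H true).Adj v)).card →
        6 * (1000 * u) ≤ ((C \ T).filter ((H true).Adj v)).card := by
      intro C T v hT hC
      have h1 := Finset.le_card_sdiff T (C.filter ((H true).Adj v))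
      rw [Finset.sdiff_eq_filter, Finset.filter_filter] at h1
      rw [Finset.sdiff_eq_filter, Finset.filter_filter]
      simp only [and_comm] at h1 ⊢
      omega
    have hSc := Finset.card_sdiff_of_subset hSA
    have hTc := Finset.card_sdiff_of_subset hTB
    refine ⟨true, A₀ \ S, Finset.sdiff_subset.trans hA₀, B₀ \ T, Finset.sdiff_subset.trans hB₀,
      1000 * u, ⟨(hAB₀.mono_left Finset.sdiff_subset).mono_right Finset.sdiff_subset,
        by omega, by omega, ?_, ?_, ?_⟩, by omega, by omega⟩
    · intro a ha
      obtain ⟨ha, haS⟩ := Finset.mem_sdiff.1 ha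
      refine hdeg _ _ _ hT (not_le.1 fun hc => haS (hLS (Finset.mem_filter.2 ⟨ha, hc⟩)))
    · intro b hb
      obtain ⟨hb, hbT⟩ := Finset.mem_sdiff.1 hb
      refine hdeg _ _ _ hS (not_le.1 fun hc => hbT (hRT (Finset.mem_filter.2 ⟨hb, hc⟩)))
    · exact fun S' hS' T' hT' => hno S' (hS'.trans Finset.sdiff_subset) T'
        (hT'.trans Finset.sdiff_subset)
  · unfold NoHole at hno
    push Not at hno
    obtain ⟨S, hSA, T, hTB, hS, hT, hST⟩ := hno
    obtain ⟨S', hS'S, hS'⟩ := Finset.exists_subset_card_eq hS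
    obtain ⟨T', hT'T, hT'⟩ := Finset.exists_subset_card_eq hT
    refine ⟨false, S', (hS'S.trans hSA).trans hA₀, T', (hT'T.trans hTB).trans hB₀, 51 * u,
      isAbsorber_of_sparse (G := H true) hu
        ((hAB₀.mono_left (hS'S.trans hSA)).mono_right (hT'T.trans hTB)) hS' hT'
        (fun a ha b hb => hH₀ a (hSA (hS'S ha)) b (hTB (hT'T hb))) ?_ ?_, le_rfl, by omega⟩
    · intro a ha
      rw [Finset.filter_eq_empty_iff.2 fun b hb => hST a (hS'S ha) b (hT'T hb)]
      simp
    · intro b hb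
      rw [Finset.filter_eq_empty_iff.2 fun a ha h => hST a (hS'S ha) b (hT'T hb) h.symm]
      simp

end AbsorberExistence

section Tripartite

variable {V : Type*} {H : Bool → SimpleGraph V} {A B C S X Y : Finset V}

/-- Any vertex of `X` is joined to any vertex of `Y` in one of the two colours. -/
def IsColoured (H : Bool → SimpleGraph V) (X Y : Finset V) : Prop :=
  ∀ x ∈ X, ∀ y ∈ Y, ∀ b, (H b).Adj x y ∨ (H !b).Adj x y

lemma IsColoured.symm (h : IsColoured H X Y) : IsColoured H Y X :=
  fun y hy x hx b => (h x hx y hy b).imp Adj.symm Adj.symm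

lemma IsColoured.mono (h : IsColoured H X Y) {X' Y' : Finset V} (hX : X' ⊆ X) (hY : Y' ⊆ Y) :
    IsColoured H X' Y' :=
  fun x hx y hy => h x (hX hx) y (hY hy)

lemma IsColoured.union_left (h : IsColoured H X Y) (h' : IsColoured H S Y) :
    IsColoured H (X ∪ S) Y :=
  fun x hx => (Finset.mem_union.1 hx).elim (h x) (h' x)

/-- The lists in `ls` are disjoint monochromatic cycles which together cover exactly `S`. -/
def IsCycleCover (H : Bool → SimpleGraph V) (S : Finset V) (ls : List (List V)) : Prop :=
  ls.flatten.Nodup ∧ (∀ l ∈ ls, ∃ b, IsCycleList (H b) l) ∧ ls.flatten.toFinset = S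

/-- A packing can be added to a cover of its leftover. -/
lemma IsCycleCover.append {ls ls' : List (List V)} (hp : IsCyclePacking H X Y ls)
    (hS : Disjoint (X ∪ Y) S)
    (hc : IsCycleCover H
      ((X \ ls.flatten.toFinset) ∪ (Y \ ls.flatten.toFinset) ∪ S) ls') :
    IsCycleCover H (X ∪ Y ∪ S) (ls ++ ls') := by
  obtain ⟨h1, h2, h3⟩ := hc
  have hsub := hp.subset
  refine ⟨?_, ?_, ?_⟩
  · rw [List.flatten_append, List.nodup_append]
    refine ⟨hp.1, h1, ?_⟩
    rintro v hv w hw rfl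
    rw [← List.mem_toFinset] at hv hw
    have h4 := Finset.disjoint_left.1 hS (hsub hv)
    rw [h3] at hw
    simp only [Finset.mem_union, Finset.mem_sdiff] at hw
    rcases hw with (hw | hw) | hw
    exacts [hw.2 hv, hw.2 hv, h4 hw]
  · intro l hl
    rcases List.mem_append.1 hl with hl | hl
    · obtain ⟨b, hb⟩ := hp.2 l hl
      exact ⟨b, hb.mono between_le⟩
    · exact h2 l hl
  · rw [List.flatten_append, List.toFinset_append, h3, ← Finset.union_sdiff_distrib,
      ← Finset.union_assoc, Finset.union_sdiff_of_subset hsub]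

lemma exists_isCycleCover_of_le {m : ℕ} (hm : 10 ^ 27 ≤ m) (hAB : Disjoint A B)
    (hAC : Disjoint A C) (hBC : Disjoint B C) (hHAB : IsColoured H A B) (hHAC : IsColoured H A C)
    (hHBC : IsColoured H B C) (hsum : A.card + B.card + C.card = 2 * m) (hA : A.card ≤ m)
    (hB : B.card ≤ m) (hCA : C.card ≤ A.card) (hCB : C.card ≤ B.card) :
    ∃ ls, ls.length ≤ 12 ∧ IsCycleCover H (A ∪ B ∪ C) ls := by
  obtain ⟨h, hh1, hh2⟩ : ∃ h, 10 ^ 8 * h ≤ m ∧ m < 10 ^ 8 * (h + 1) :=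
    ⟨m / 10 ^ 8, by omega, by omega⟩
  have hq : 100 * (2 * 10 ^ 8 + 1) ^ 2 ≤ h := by norm_num; omega
  obtain ⟨c, A₀, hA₀, B₀, hB₀, s, habs, hs, hk⟩ := exists_isAbsorber (H := H) (u := h) (by omega)
    hAB (by omega) (by omega) fun a ha b hb => hHAB a ha b hb true
  have hAB₀ := habs.2.1
  have hA₀c := Finset.card_sdiff_of_subset hA₀
  have hB₀c := Finset.card_sdiff_of_subset hB₀
  obtain ⟨B₃, hB₃, hB₃c⟩ : ∃ T ⊆ B \ B₀, T.card = m - A.card :=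
    Finset.exists_subset_card_eq (by omega)
  obtain ⟨A₂, hA₂, hA₂c⟩ : ∃ T ⊆ A \ A₀, T.card = m - B.card :=
    Finset.exists_subset_card_eq (by omega)
  obtain ⟨C₃, hC₃, hC₃c⟩ : ∃ T ⊆ C, T.card = m - A.card :=
    Finset.exists_subset_card_eq (by omega)
  set C₂ := C \ C₃ with hC₂
  set A₁ := (A \ A₀) \ A₂ with hA₁
  set B₁ := (B \ B₀) \ B₃ with hB₁
  have hC₂c : C₂.card = C.card - C₃.card := Finset.card_sdiff_of_subset hC₃
  have hA₁c : A₁.card = (A \ A₀).card - A₂.card := Finset.card_sdiff_of_subset hA₂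
  have hB₁c : B₁.card = (B \ B₀).card - B₃.card := Finset.card_sdiff_of_subset hB₃
  have hA₁A : A₁ ⊆ A := Finset.sdiff_subset.trans Finset.sdiff_subset
  have hA₂A : A₂ ⊆ A := hA₂.trans Finset.sdiff_subset
  have hB₁B : B₁ ⊆ B := Finset.sdiff_subset.trans Finset.sdiff_subset
  have hB₃B : B₃ ⊆ B := hB₃.trans Finset.sdiff_subset
  have hC₂C : C₂ ⊆ C := Finset.sdiff_subset
  obtain ⟨l₁, hl₁, p₁, r₁⟩ := exists_isCyclePacking_almost (H := H) (q := 2 * 10 ^ 8) (h := h)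
    ((hAB.mono_left hA₁A).mono_right hB₁B) (by omega) (by omega) hq (hHAB.mono hA₁A hB₁B)
  obtain ⟨l₂, hl₂, p₂, r₂⟩ := exists_isCyclePacking_almost (H := H) (q := 2 * 10 ^ 8) (h := h)
    ((hAC.mono_left hA₂A).mono_right hC₂C) (by omega) (by omega) hq (hHAC.mono hA₂A hC₂C)
  obtain ⟨l₃, hl₃, p₃, r₃⟩ := exists_isCyclePacking_almost (H := H) (q := 2 * 10 ^ 8) (h := h)
    ((hBC.symm.mono_left hC₃).mono_right hB₃B) (by omega) (by omega) hq (hHBC.symm.mono hC₃ hB₃B)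
  have e₁ := p₁.card_sdiff_eq ((hAB.mono_left hA₁A).mono_right hB₁B) (by omega)
  have e₂ := p₂.card_sdiff_eq ((hAC.mono_left hA₂A).mono_right hC₂C) (by omega)
  have e₃ := p₃.card_sdiff_eq ((hBC.symm.mono_left hC₃).mono_right hB₃B) (by omega)
  have dA₁ : Disjoint A₁ A₂ := Finset.sdiff_disjoint
  have dA₂ : Disjoint A₁ A₀ := Finset.sdiff_disjoint.mono_left Finset.sdiff_subset
  have dA₃ : Disjoint A₂ A₀ := Finset.sdiff_disjoint.mono_left hA₂
  have dB₁ : Disjoint B₁ B₃ := Finset.sdiff_disjoint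
  have dB₂ : Disjoint B₁ B₀ := Finset.sdiff_disjoint.mono_left Finset.sdiff_subset
  have dB₃ : Disjoint B₃ B₀ := Finset.sdiff_disjoint.mono_left hB₃
  have dC : Disjoint C₂ C₃ := Finset.sdiff_disjoint
  have uA : A = A₁ ∪ A₂ ∪ A₀ := by
    rw [hA₁, Finset.sdiff_union_of_subset hA₂, Finset.sdiff_union_of_subset hA₀]
  have uB : B = B₁ ∪ B₃ ∪ B₀ := by
    rw [hB₁, Finset.sdiff_union_of_subset hB₃, Finset.sdiff_union_of_subset hB₀]
  have uC : C = C₂ ∪ C₃ := by rw [hC₂, Finset.sdiff_union_of_subset hC₃]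
  clear_value A₁ B₁ C₂
  subst uA uB uC
  set W₁ := (A₁ \ l₁.flatten.toFinset) ∪ (A₂ \ l₂.flatten.toFinset) ∪
    (C₃ \ l₃.flatten.toFinset) with hW₁
  set W₂ := (B₁ \ l₁.flatten.toFinset) ∪ (C₂ \ l₂.flatten.toFinset) ∪
    (B₃ \ l₃.flatten.toFinset) with hW₂
  have sW₁ : W₁ ⊆ A₁ ∪ A₂ ∪ C₃ := Finset.union_subset_union
    (Finset.union_subset_union Finset.sdiff_subset Finset.sdiff_subset) Finset.sdiff_subset
  have sW₂ : W₂ ⊆ B₁ ∪ C₂ ∪ B₃ := Finset.union_subset_union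
    (Finset.union_subset_union Finset.sdiff_subset Finset.sdiff_subset) Finset.sdiff_subset
  simp only [Finset.disjoint_union_left, Finset.disjoint_union_right, and_assoc] at hAB hAC hBC
  obtain ⟨t1, t2, t3, t4, t5, t6, t7, t8, t9⟩ := hAB
  obtain ⟨t10, t11, t12, t13, t14, t15⟩ := hAC
  obtain ⟨t16, t17, t18, t19, t20, t21⟩ := hBC
  have hcard : ∀ {P Q R P' Q' R' : Finset V}, Disjoint P Q → Disjoint P R → Disjoint Q R →
      (P \ P' ∪ Q \ Q' ∪ R \ R').card = (P \ P').card + (Q \ Q').card + (R \ R').card := by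
    intro P Q R P' Q' R' h1 h2 h3
    rw [Finset.card_union_of_disjoint, Finset.card_union_of_disjoint
      ((h1.mono_left Finset.sdiff_subset).mono_right Finset.sdiff_subset)]
    exact ((h2.sup_left h3).mono_left (Finset.union_subset_union Finset.sdiff_subset
      Finset.sdiff_subset)).mono_right Finset.sdiff_subset
  have cW₁ := hcard (P' := l₁.flatten.toFinset) (Q' := l₂.flatten.toFinset)
    (R' := l₃.flatten.toFinset) dA₁ (by assumption : Disjoint A₁ C₃)
    (by assumption : Disjoint A₂ C₃)
  have cW₂ := hcard (P' := l₁.flatten.toFinset) (Q' := l₂.flatten.toFinset)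
    (R' := l₃.flatten.toFinset) (by assumption : Disjoint B₁ C₂) dB₁
    (by assumption : Disjoint B₃ C₂).symm
  rw [← hW₁] at cW₁
  rw [← hW₂] at cW₂
  have dW₁₂ : Disjoint (A₁ ∪ A₂ ∪ C₃) (B₁ ∪ C₂ ∪ B₃) := by
    simp only [Finset.disjoint_union_left, Finset.disjoint_union_right]
    repeat' apply And.intro
    all_goals first | assumption | (apply Disjoint.symm; assumption)
  have dW₁ : Disjoint (A₁ ∪ A₂ ∪ C₃) A₀ ∧ Disjoint (A₁ ∪ A₂ ∪ C₃) B₀ := by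
    simp only [Finset.disjoint_union_left]
    repeat' apply And.intro
    all_goals first | assumption | (apply Disjoint.symm; assumption)
  have dW₂ : Disjoint (B₁ ∪ C₂ ∪ B₃) A₀ ∧ Disjoint (B₁ ∪ C₂ ∪ B₃) B₀ := by
    simp only [Finset.disjoint_union_left]
    repeat' apply And.intro
    all_goals first | assumption | (apply Disjoint.symm; assumption)
  have hH₁ : IsColoured H W₁ B₀ := by
    refine ((((hHAB.mono hA₁A hB₀).union_left (hHAB.mono hA₂A hB₀))).union_left
      (hHBC.symm.mono hC₃ hB₀)).mono sW₁ subset_rfl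
  have hH₂ : IsColoured H W₂ A₀ := by
    refine ((((hHAB.symm.mono hB₁B hA₀).union_left (hHAC.symm.mono hC₂C hA₀))).union_left
      (hHAB.symm.mono hB₃B hA₀)).mono sW₂ subset_rfl
  obtain ⟨l₄, hl₄, hcov⟩ := habs.exists_cover ((dW₁₂.mono_left sW₁).mono_right sW₂)
    (dW₁.1.mono_left sW₁) (dW₁.2.mono_left sW₁) (dW₂.1.mono_left sW₂) (dW₂.2.mono_left sW₂)
    (by omega) (by omega) (fun w hw b hb => hH₁ w hw b hb c) fun w hw b hb => hH₂ w hw b hb c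
  change IsCycleCover H _ l₄ at hcov
  have hcov₃ := IsCycleCover.append p₃
    (S := (A₁ \ l₁.flatten.toFinset) ∪ (B₁ \ l₁.flatten.toFinset) ∪
      ((A₂ \ l₂.flatten.toFinset) ∪ (C₂ \ l₂.flatten.toFinset) ∪ (A₀ ∪ B₀)))
    (ls' := l₄) ?_ (by convert hcov using 1; rw [hW₁, hW₂]; ac_rfl)
  · have hcov₂ := IsCycleCover.append p₂
      (S := (A₁ \ l₁.flatten.toFinset) ∪ (B₁ \ l₁.flatten.toFinset) ∪ (C₃ ∪ B₃ ∪ (A₀ ∪ B₀)))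
      (ls' := l₃ ++ l₄) ?_ (by convert hcov₃ using 1; ac_rfl)
    · have hcov₁ := IsCycleCover.append p₁ (S := A₂ ∪ C₂ ∪ (C₃ ∪ B₃ ∪ (A₀ ∪ B₀)))
        (ls' := l₂ ++ (l₃ ++ l₄)) ?_ (by convert hcov₂ using 1; ac_rfl)
      · refine ⟨_, ?_, by convert hcov₁ using 1; ac_rfl⟩
        simp only [List.length_append]
        omega
      · simp only [Finset.disjoint_union_left, Finset.disjoint_union_right]
        repeat' apply And.intro
        all_goals first | assumption | (apply Disjoint.symm; assumption)
    · refine Disjoint.mono_right (Finset.union_subset_union (Finset.union_subset_union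
        Finset.sdiff_subset Finset.sdiff_subset) subset_rfl) ?_
      simp only [Finset.disjoint_union_left, Finset.disjoint_union_right]
      repeat' apply And.intro
      all_goals first | assumption | (apply Disjoint.symm; assumption)
  · refine Disjoint.mono_right (Finset.union_subset_union (Finset.union_subset_union
      Finset.sdiff_subset Finset.sdiff_subset) (Finset.union_subset_union
        (Finset.union_subset_union Finset.sdiff_subset Finset.sdiff_subset) subset_rfl)) ?_
    simp only [Finset.disjoint_union_left, Finset.disjoint_union_right]
    repeat' apply And.intro
    all_goals first | assumption | (apply Disjoint.symm; assumption)

/-- A large complete tripartite graph whose classes have at most half of all vertices can be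
covered by twelve disjoint monochromatic cycles if its number of vertices is even. -/
theorem exists_isCycleCover {m : ℕ} (hm : 10 ^ 27 ≤ m) (hAB : Disjoint A B)
    (hAC : Disjoint A C) (hBC : Disjoint B C) (hHAB : IsColoured H A B) (hHAC : IsColoured H A C)
    (hHBC : IsColoured H B C) (hsum : A.card + B.card + C.card = 2 * m) (hA : A.card ≤ m)
    (hB : B.card ≤ m) (hC : C.card ≤ m) :
    ∃ ls, ls.length ≤ 12 ∧ IsCycleCover H (A ∪ B ∪ C) ls := by
  by_cases h1 : C.card ≤ A.card ∧ C.card ≤ B.card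
  · exact exists_isCycleCover_of_le hm hAB hAC hBC hHAB hHAC hHBC hsum hA hB h1.1 h1.2
  by_cases h2 : B.card ≤ A.card ∧ B.card ≤ C.card
  · rw [Finset.union_right_comm]
    exact exists_isCycleCover_of_le hm hAC hAB hBC.symm hHAC hHAB hHBC.symm (by omega) hA hC
      h2.1 h2.2
  · rw [Finset.union_assoc, Finset.union_comm]
    exact exists_isCycleCover_of_le hm hBC hAB.symm hAC.symm hHBC hHAB.symm hHAC.symm
      (by omega) hB hC (by omega) (by omega)

end Tripartite

section Multipartite

variable {V : Type*} {G : SimpleGraph V} {c : Sym2 V → Bool}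

lemma monoSubgraph_adj_or_of_adj {x y : V} (h : G.Adj x y) (b : Bool) :
    (monoSubgraph G c b).Adj x y ∨ (monoSubgraph G c !b).Adj x y := by
  simp only [monoSubgraph, SimpleGraph.fromEdgeSet_adj, Set.mem_ofPred_eq, mem_edgeSet]
  cases b <;> cases hc : c s(x, y) <;> simp [h, h.ne]

/-- The classes of a function to `ℕ` all of whose fibres are small can be grouped into three
small sets of consecutive classes. -/
lemma exists_three_groups {n k : ℕ} (S : Finset V) (f : V → ℕ) (hn : n < 2 * S.card)
    (hf : ∀ v ∈ S, f v < k) :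
    ∃ j, 2 * (S.filter fun v => f v < j).card ≤ n ∧
      n < 2 * (S.filter fun v => f v ≤ j).card := by
  have hex : ∃ j, n < 2 * (S.filter fun v => f v ≤ j).card :=
    ⟨k, by rwa [Finset.filter_true_of_mem fun v hv => (hf v hv).le]⟩
  refine ⟨Nat.find hex, ?_, Nat.find_spec hex⟩
  rcases h : Nat.find hex with _ | j
  · simp
  · have := Nat.find_min hex (m := j) (by omega)
    simp only [Nat.lt_succ_iff]
    omega

lemma exists_list_cover [Fintype V] {k : ℕ} (f : V → Fin k) (hG : ∀ x y, G.Adj x y ↔ f x ≠ f y)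
    (hfair : ∀ i : Fin k, 2 * ({v | f v = i} : Set V).ncard ≤ Fintype.card V)
    (hn : 10 ^ 28 < Fintype.card V) :
    ∃ ls : List (List V), ls.length ≤ 13 ∧ ls.flatten.Nodup ∧
      (∀ l ∈ ls, ∃ b, IsMonoCycleSet G c b {x | x ∈ l}) ∧ ∀ v, v ∈ ls.flatten := by
  obtain ⟨j, hj₁, hj₂⟩ := exists_three_groups (n := Fintype.card V) (k := k) Finset.univ
    (fun v => (f v : ℕ)) (by rw [Finset.card_univ]; omega) fun v _ => (f v).2
  have hj₃ : 2 * (Finset.univ.filter fun v => (f v : ℕ) = j).card ≤ Fintype.card V := by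
    by_cases hjk : j < k
    · have := hfair ⟨j, hjk⟩
      rw [Set.ncard_eq_toFinset_card'] at this
      convert this using 3
      ext v
      simp [Fin.ext_iff]
    · rw [Finset.filter_eq_empty_iff.2 fun v _ => by have := (f v).2; omega]
      simp
  have hj₄ := Finset.card_filter_add_card_filter_not (s := (Finset.univ : Finset V))
    fun v => (f v : ℕ) ≤ j
  obtain ⟨F, hF⟩ : ∃ F : Finset V → (ℕ → Prop) → Finset V, ∀ S p v,
      v ∈ F S p ↔ v ∈ S ∧ p (f v) :=
    ⟨fun S p => S.filter fun v => p (f v), fun S p v => Finset.mem_filter⟩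
  have hgroups : ∀ S : Finset V, ∃ A B C : Finset V, A ∪ B ∪ C = S ∧
      A.card + B.card + C.card = S.card ∧ Disjoint A B ∧ Disjoint A C ∧ Disjoint B C ∧
      2 * A.card ≤ Fintype.card V ∧ 2 * B.card ≤ Fintype.card V ∧ 2 * C.card ≤ Fintype.card V ∧
      IsColoured (monoSubgraph G c) A B ∧ IsColoured (monoSubgraph G c) A C ∧
      IsColoured (monoSubgraph G c) B C := by
    intro S
    have hsub : ∀ p : ℕ → Prop, (F S p).card ≤ (Finset.univ.filter fun v => p (f v)).card :=
      fun p => Finset.card_le_card fun v hv => by simpa using ((hF S p v).1 hv).2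
    have hdis : ∀ p q : ℕ → Prop, (∀ i, p i → ¬ q i) →
        Disjoint (F S p) (F S q) ∧ IsColoured (monoSubgraph G c) (F S p) (F S q) := by
      refine fun p q hpq => ⟨Finset.disjoint_left.2 fun v hv hv' =>
        hpq _ ((hF S p v).1 hv).2 ((hF S q v).1 hv').2, fun x hx y hy =>
        monoSubgraph_adj_or_of_adj ((hG x y).2 fun h => ?_)⟩
      have hy' := ((hF S q y).1 hy).2
      rw [← h] at hy'
      exact hpq _ ((hF S p x).1 hx).2 hy'
    obtain ⟨d₁, e₁⟩ := hdis (· < j) (· = j) fun i h => h.ne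
    obtain ⟨d₂, e₂⟩ := hdis (· < j) (fun i => ¬ i ≤ j) fun i h h' => h' (le_of_lt h)
    obtain ⟨d₃, e₃⟩ := hdis (· = j) (fun i => ¬ i ≤ j) fun i h h' => h' (le_of_eq h)
    have hu : F S (· < j) ∪ F S (· = j) ∪ F S (fun i => ¬ i ≤ j) = S := by
      ext v
      simp only [Finset.mem_union, hF]
      have := lt_trichotomy (f v : ℕ) j
      rw [not_le]
      tauto
    have c₁ : 2 * (F S (· < j)).card ≤ Fintype.card V :=
      Nat.le_trans (Nat.mul_le_mul_left 2 (hsub _)) (by convert hj₁)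
    have c₂ : 2 * (F S (· = j)).card ≤ Fintype.card V :=
      Nat.le_trans (Nat.mul_le_mul_left 2 (hsub _)) (by convert hj₃)
    have c₃ : 2 * (F S (fun i => ¬ i ≤ j)).card ≤ Fintype.card V :=
      Nat.le_trans (Nat.mul_le_mul_left 2 (hsub _)) (by
        rw [Finset.card_univ] at hj₄
        convert (by omega : 2 * (Finset.univ.filter fun v => ¬ (f v : ℕ) ≤ j).card ≤
          Fintype.card V))
    refine ⟨_, _, _, hu, ?_, d₁, d₂, d₃, c₁, c₂, c₃, e₁, e₂, e₃⟩
    conv_rhs => rw [← hu]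
    rw [Finset.card_union_of_disjoint, Finset.card_union_of_disjoint d₁]
    exact Finset.disjoint_union_left.2 ⟨d₂, d₃⟩
  have hconv : ∀ (S : Finset V) {m : ℕ}, S.card = 2 * m → Fintype.card V < 2 * (m + 1) →
      ∃ ls, ls.length ≤ 12 ∧ IsCycleCover (monoSubgraph G c) S ls := by
    intro S m hS hm
    obtain ⟨A, B, C, rfl, h1, h2, h3, h4, h5, h6, h7, h8, h9, h10⟩ := hgroups S
    exact exists_isCycleCover (m := m) (by omega) h2 h3 h4 h8 h9 h10 (by omega) (by omega) (by omega)
      (by omega)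
  rcases Nat.even_or_odd' (Fintype.card V) with ⟨m, hm | hm⟩
  · obtain ⟨ls, h1, h2, h3, h4⟩ := hconv Finset.univ (m := m) (by rw [Finset.card_univ, hm])
      (by omega)
    refine ⟨ls, by omega, h2, fun l hl => ?_, fun v => ?_⟩
    · obtain ⟨b, hb⟩ := h3 l hl
      exact ⟨b, hb.isMonoCycleSet⟩
    · rw [← List.mem_toFinset, h4]
      exact Finset.mem_univ v
  · obtain ⟨v₀⟩ : Nonempty V := Fintype.card_pos_iff.1 (by omega)
    obtain ⟨ls, h1, h2, h3, h4⟩ := hconv (Finset.univ.erase v₀) (m := m)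
      (by rw [Finset.card_erase_of_mem (Finset.mem_univ _), Finset.card_univ]; omega) (by omega)
    have hmem : ∀ v, v ∈ ls.flatten ↔ v ≠ v₀ := fun v => by
      rw [← List.mem_toFinset, h4]; simp
    refine ⟨[v₀] :: ls, by rw [List.length_cons]; omega, ?_, fun l hl => ?_, fun v => ?_⟩
    · rw [List.flatten_cons, List.singleton_append, List.nodup_cons]
      exact ⟨fun h => (hmem v₀).1 h rfl, h2⟩
    · rcases List.mem_cons.1 hl with rfl | hl
      · exact ⟨true, Or.inr (Or.inl ⟨v₀, by ext; simp⟩)⟩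
      · obtain ⟨b, hb⟩ := h3 l hl
        exact ⟨b, hb.isMonoCycleSet⟩
    · rw [List.flatten_cons, List.singleton_append, List.mem_cons, hmem]
      exact em _

end Multipartite

end

/-- There is an `n₀` such that every fair complete `k`-partite graph on more than `n₀`
vertices whose edges are coloured red and blue can be partitioned into 14 vertex-disjoint
monochromatic (possibly degenerate) cycles. -/
theorem stmt3 :
    ∃ n₀ : ℕ, ∀ (V : Type) [Fintype V],
      ∀ (k : ℕ) (f : V → Fin k) (G : SimpleGraph V) (c : Sym2 V → Bool),
        Function.Surjective f → (∀ x y, G.Adj x y ↔ f x ≠ f y) →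
        (∀ i : Fin k, 2 * ({v | f v = i} : Set V).ncard ≤ Fintype.card V) →
        n₀ < Fintype.card V →
        ∃ S : Fin 14 → Set V, (∀ i, ∃ b, IsMonoCycleSet G c b (S i)) ∧
          (∀ i j, i ≠ j → Disjoint (S i) (S j)) ∧ (⋃ i, S i) = Set.univ := by
  refine ⟨10 ^ 28, fun V _ k f G c _ hG hfair hn => ?_⟩
  obtain ⟨ls, hlen, hnodup, hcyc, hcov⟩ := exists_list_cover (c := c) f hG hfair hn
  refine ⟨fun i => {x | x ∈ ls.getD i []}, fun i => ?_, ?_, ?_⟩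
  · rcases lt_or_ge (i : ℕ) ls.length with h | h
    · simp only [List.getD_eq_getElem _ _ h]
      exact hcyc _ (List.getElem_mem h)
    · simp only [List.getD_eq_default _ _ h]
      exact ⟨true, Or.inl (by simp)⟩
  · have hpair := List.pairwise_iff_getElem.1 (List.nodup_flatten.1 hnodup).2
    have hlt : ∀ i j : Fin 14, i < j →
        Disjoint {x | x ∈ ls.getD i []} {x | x ∈ ls.getD j []} := by
      intro i j hij
      rcases lt_or_ge (j : ℕ) ls.length with h | h
      · have h' : (i : ℕ) < ls.length := lt_trans hij h
        simp only [List.getD_eq_getElem _ _ h, List.getD_eq_getElem _ _ h']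
        exact Set.disjoint_left.2 fun x hx hy => hpair i j h' h hij hx hy
      · simp only [List.getD_eq_default _ _ h]
        simp
    intro i j hij
    rcases lt_or_gt_of_ne hij with h | h
    exacts [hlt i j h, (hlt j i h).symm]
  · refine Set.eq_univ_of_forall fun v => ?_
    obtain ⟨l, hl, hv⟩ := List.mem_flatten.1 (hcov v)
    obtain ⟨i, hi, rfl⟩ := List.getElem_of_mem hl
    refine Set.mem_iUnion.2 ⟨⟨i, by omega⟩, ?_⟩
    change v ∈ ls.getD i []
    rwa [List.getD_eq_getElem _ _ hi]
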